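/- Let S be the bi-coloured system derived from a tree T on n ≥ 3 vertices, and let t(n) = ⌊n²/4 + n + 1⌋ if n ≥ 6 and t(n) = n(n−1)/2 + 1 if 3 ≤ n ≤ 6. Then m_S = t(n) if and only if either (1) n ≤ 6 and T is a path, or (2) n ≥ 6 and T is isomorphic to S(a*, n − a*), where a* = (n−1)/2 if n is odd, and a* ∈ {n/2 − 1, n/2} if n is even. -/

import Mathlib

/-- Three vertices `x, y, z` of a graph are collinear if one of them lies on a
shortest path (in a tree: the unique path) between the other two, i.e.
`d(x,y) + d(y,z) = d(x,z)` for some ordering of the triple. -/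
def Collin {V : Type*} (G : SimpleGraph V) (x y z : V) : Prop :=
  G.dist x y + G.dist y z = G.dist x z ∨
  G.dist y x + G.dist x z = G.dist y z ∨
  G.dist x z + G.dist z y = G.dist x y

/-- The red line generated by two distinct vertices `u`, `v` in the bi-coloured
system derived from the graph `G`: a triple is red iff it is collinear. -/
def treeRedLine {V : Type*} (G : SimpleGraph V) (u v : V) : Set V :=
  {u, v} ∪ {p | p ≠ u ∧ p ≠ v ∧ Collin G u v p}

/-- The blue line generated by two distinct vertices `u`, `v` in the bi-coloured
system derived from the graph `G`: a triple is blue iff it is not collinear. -/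
def treeBlueLine {V : Type*} (G : SimpleGraph V) (u v : V) : Set V :=
  {u, v} ∪ {p | p ≠ u ∧ p ≠ v ∧ ¬ Collin G u v p}

/-- The set of distinct red lines of the system derived from `G`. -/
def treeRedLines {V : Type*} (G : SimpleGraph V) : Set (Set V) :=
  {L | ∃ u v : V, u ≠ v ∧ L = treeRedLine G u v}

/-- The set of distinct blue lines of the system derived from `G`. -/
def treeBlueLines {V : Type*} (G : SimpleGraph V) : Set (Set V) :=
  {L | ∃ u v : V, u ≠ v ∧ L = treeBlueLine G u v}

/-- `m_S(R)`, the number of distinct red lines of the system derived from `G`. -/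
noncomputable def treeNumRed {V : Type*} (G : SimpleGraph V) : ℕ :=
  (treeRedLines G).ncard

/-- `m_S(B)`, the number of distinct blue lines of the system derived from `G`. -/
noncomputable def treeNumBlue {V : Type*} (G : SimpleGraph V) : ℕ :=
  (treeBlueLines G).ncard

/-- Two vertices are twins if they are distinct, non-adjacent and have identical
neighbourhoods. -/
def Twins {V : Type*} (G : SimpleGraph V) (x y : V) : Prop :=
  x ≠ y ∧ ¬ G.Adj x y ∧ G.neighborSet x = G.neighborSet y

/-- The tree `S(p, q)`: a path on `q` vertices (`0, 1, …, q−1`) with `p` pendant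
leaves (`q, …, q+p−1`) attached to the endpoint `q−1` of the path. -/
def Spq (p q : ℕ) : SimpleGraph (Fin (q + p)) :=
  SimpleGraph.fromRel (fun i j =>
    ((i : ℕ) + 1 = (j : ℕ) ∧ (j : ℕ) < q) ∨ ((i : ℕ) = q - 1 ∧ q ≤ (j : ℕ)))

/-- The double broom: a path on `q` vertices (`0, …, q−1`) with `p₁` pendant
leaves (`q, …, q+p₁−1`) attached to the endpoint `0` and `p₂` pendant leaves
(`q+p₁, …, q+p₁+p₂−1`) attached to the other endpoint `q−1`. -/
def DoubleBroom (p₁ p₂ q : ℕ) : SimpleGraph (Fin (q + p₁ + p₂)) :=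
  SimpleGraph.fromRel (fun i j =>
    ((i : ℕ) + 1 = (j : ℕ) ∧ (j : ℕ) < q) ∨
    ((i : ℕ) = 0 ∧ q ≤ (j : ℕ) ∧ (j : ℕ) < q + p₁) ∨
    ((i : ℕ) = q - 1 ∧ q + p₁ ≤ (j : ℕ)))

/-- `t(n) = ⌊n²/4 + n + 1⌋` for `n ≥ 6` and `t(n) = n(n−1)/2 + 1` for `n ≤ 6`
(the two values agree at `n = 6`). -/
def tBound (n : ℕ) : ℕ := if 6 ≤ n then n ^ 2 / 4 + n + 1 else n * (n - 1) / 2 + 1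

namespace TreeLines

section Dist

variable {V : Type*} {G : SimpleGraph V}

lemma exists_adj_toward (hG : G.Connected) {x p : V} (h : x ≠ p) :
    ∃ c, G.Adj x c ∧ G.dist c p + 1 = G.dist x p := by
  obtain ⟨w, hw⟩ := hG.exists_walk_length_eq_dist x p
  cases w with
  | nil => exact absurd rfl h
  | @cons _ c _ hadj w' =>
    refine ⟨c, hadj, ?_⟩
    have h1 := G.dist_le w'
    have h2 := hG.dist_triangle (u := x) (v := c) (w := p)
    rw [SimpleGraph.dist_eq_one_iff_adj.2 hadj] at h2
    simp only [SimpleGraph.Walk.length_cons] at hw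
    omega

lemma toward_unique (hG : G.IsTree) {x c c' p : V} (hc : G.Adj x c)
    (hcp : G.dist c p + 1 = G.dist x p) (hc' : G.Adj x c')
    (hcp' : G.dist c' p + 1 = G.dist x p) : c = c' := by
  obtain ⟨w, hw⟩ := hG.connected.exists_walk_length_eq_dist c p
  obtain ⟨w', hw'⟩ := hG.connected.exists_walk_length_eq_dist c' p
  have h1 : (SimpleGraph.Walk.cons hc w).IsPath :=
    SimpleGraph.Walk.isPath_of_length_eq_dist _ (by simp; omega)
  have h2 : (SimpleGraph.Walk.cons hc' w').IsPath :=
    SimpleGraph.Walk.isPath_of_length_eq_dist _ (by simp; omega)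
  have h3 := congrArg SimpleGraph.Walk.snd ((hG.existsUnique_path x p).unique h1 h2)
  simpa using h3

lemma dist_adj_cases (hG : G.IsTree) {x c : V} (h : G.Adj x c) (p : V) :
    G.dist c p + 1 = G.dist x p ∨ G.dist c p = G.dist x p + 1 := by
  have := hG.dist_eq_dist_add_one_of_adj p h
  rw [G.dist_comm (u := c), G.dist_comm (u := x)]
  omega

/-- If the edge `xc` points towards `b` and away from `a`, then it lies on the path from
`a` to `b`. -/
lemma dist_through (hG : G.IsTree) {x c a b : V} (h : G.Adj x c)
    (hb : G.dist c b + 1 = G.dist x b) (ha : G.dist c a = G.dist x a + 1) :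
    G.dist a b = G.dist x a + G.dist x b := by
  induction hn : G.dist c b generalizing x c with
  | zero =>
    obtain rfl := hG.connected.dist_eq_zero_iff.1 hn
    rw [G.dist_comm]
    omega
  | succ n ih =>
    have hne : c ≠ b := by
      rintro rfl
      simp at hn
    obtain ⟨e, he, heb⟩ := exists_adj_toward hG.connected hne
    rcases dist_adj_cases hG he a with h1 | h1
    · obtain rfl := toward_unique hG h.symm (by omega) he h1
      omega
    · have := ih he heb h1 (by omega)
      omega

lemma dist_pos (hG : G.IsTree) {a b : V} (h : a ≠ b) : 0 < G.dist a b :=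
  hG.connected.pos_dist_of_ne h

lemma dist_tri (hG : G.IsTree) (a b c : V) : G.dist a c ≤ G.dist a b + G.dist b c :=
  hG.connected.dist_triangle

lemma dist_adj {a b : V} (h : G.Adj a b) : G.dist a b = 1 := SimpleGraph.dist_eq_one_iff_adj.2 h

lemma collin_swap {u v p : V} (h : Collin G u v p) : Collin G v u p := by
  have := G.dist_comm (u := u) (v := v)
  have := G.dist_comm (u := u) (v := p)
  have := G.dist_comm (u := v) (v := p)
  unfold Collin at *
  omega

lemma collin_comm {u v p : V} : Collin G u v p ↔ Collin G v u p := ⟨collin_swap, collin_swap⟩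

lemma collin_left (u v : V) : Collin G u v u := by simp [Collin, G.dist_comm]

lemma collin_right (u v : V) : Collin G u v v := by simp [Collin]

lemma collin_of_between {u v x : V} (h : G.dist x u + G.dist x v = G.dist u v) :
    Collin G u v x := by
  right; right
  rw [G.dist_comm (u := u) (v := x)]
  exact h

lemma collin_of_adj (hG : G.IsTree) {u v : V} (h : G.Adj u v) (p : V) : Collin G u v p := by
  have h1 := dist_adj_cases hG h p
  have h2 := dist_adj h
  have h3 := G.dist_comm (u := u) (v := v)
  unfold Collin
  omega

/-- A vertex hanging off the interior of the path from `u` to `v` is not collinear with `u`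
and `v`. -/
lemma not_collin_of_hang (hG : G.IsTree) {u v x p : V} (hu : x ≠ u) (hv : x ≠ v) (hp : x ≠ p)
    (h : G.dist x u + G.dist x v = G.dist u v) (hpu : G.dist p u = G.dist x p + G.dist x u)
    (hpv : G.dist p v = G.dist x p + G.dist x v) : ¬ Collin G u v p := by
  have := dist_pos hG hu
  have := dist_pos hG hv
  have := dist_pos hG hp
  have := G.dist_comm (u := u) (v := v)
  have := G.dist_comm (u := u) (v := p)
  have := G.dist_comm (u := v) (v := p)
  unfold Collin
  omega

/-- The boundary vertex of a hanging component lies strictly inside the path. -/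
lemma between_of_adj (hG : G.IsTree) {u v a c : V} (hac : G.Adj a c) (hc : ¬ Collin G u v c)
    (ha : Collin G u v a) :
    a ≠ u ∧ a ≠ v ∧ G.dist a u + G.dist a v = G.dist u v ∧
      G.dist c u = G.dist a u + 1 ∧ G.dist c v = G.dist a v + 1 := by
  have main : ∀ u v, ¬ Collin G u v c → G.dist u v + G.dist v a = G.dist u a → False := by
    intro u v hc h
    by_cases hva : a = v
    · subst hva
      exact hc (collin_comm.1 (by
        have h1 := dist_adj_cases hG hac u
        have h2 := dist_adj hac
        have h3 := G.dist_comm (u := u) (v := a)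
        have h4 := G.dist_comm (u := u) (v := c)
        have h5 := G.dist_comm (u := c) (v := a)
        unfold Collin
        omega))
    · have h1 := dist_adj_cases hG hac u
      have h2 := dist_adj_cases hG hac v
      have h3 := dist_tri hG u v c
      have h6 := dist_pos hG hva
      have := G.dist_comm (u := u) (v := a)
      have := G.dist_comm (u := u) (v := c)
      have := G.dist_comm (u := v) (v := c)
      have := G.dist_comm (u := v) (v := a)
      have := G.dist_comm (u := u) (v := v)
      have h7 : ¬ (G.dist c u + 1 = G.dist a u ∧ G.dist c v = G.dist a v + 1) := by
        rintro ⟨h, h'⟩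
        have := dist_through hG hac h h'
        omega
      unfold Collin at hc
      omega
  have hau : a ≠ u := by
    rintro rfl
    exact main v a (fun h => hc (collin_comm.1 h)) (by simp)
  have hav : a ≠ v := by
    rintro rfl
    exact main u a hc (by simp)
  have hb : G.dist a u + G.dist a v = G.dist u v := by
    rcases ha with h | h | h
    · exact (main u v hc h).elim
    · exact (main v u (fun h => hc (collin_comm.1 h)) h).elim
    · rw [G.dist_comm (u := a) (v := u)]
      exact h
  refine ⟨hau, hav, hb, ?_⟩
  have h1 := dist_adj_cases hG hac u
  have h2 := dist_adj_cases hG hac v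
  have h3 := dist_tri hG u c v
  have h4 := G.dist_comm (u := u) (v := c)
  have h5 : ¬ (G.dist c u + G.dist c v = G.dist u v) := fun h => hc (collin_of_between h)
  omega

/-- Off-path neighbours of interior vertices are not collinear. -/
lemma not_collin_of_adj (hG : G.IsTree) {u v a c : V} (hac : G.Adj a c) (hau : a ≠ u)
    (hav : a ≠ v) (h : G.dist a u + G.dist a v = G.dist u v)
    (hcu : G.dist c u = G.dist a u + 1) (hcv : G.dist c v = G.dist a v + 1) :
    ¬ Collin G u v c := by
  have := dist_adj hac
  exact not_collin_of_hang hG hau hav hac.ne h (by omega) (by omega)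

/-- A vertex off the path hangs at an interior vertex with three distinct neighbours. -/
lemma exists_attach (hG : G.IsTree) {u v p : V} (hp : ¬ Collin G u v p) :
    ∃ x c, x ≠ u ∧ x ≠ v ∧ G.dist x u + G.dist x v = G.dist u v ∧ G.Adj x c ∧
      G.dist c p + 1 = G.dist x p ∧ G.dist c u = G.dist x u + 1 ∧
      G.dist c v = G.dist x v + 1 := by
  classical
  induction hn : G.dist u p using Nat.strong_induction_on generalizing p with
  | _ n ih =>
    have hpu : p ≠ u := by
      rintro rfl
      exact hp (collin_left _ _)
    obtain ⟨a, ha, hau⟩ := exists_adj_toward hG.connected hpu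
    have hc1 := G.dist_comm (u := u) (v := p)
    have hc2 := G.dist_comm (u := u) (v := a)
    by_cases hca : Collin G u v a
    · obtain ⟨h1, h2, h3, h4, h5⟩ := between_of_adj hG ha.symm hp hca
      exact ⟨a, p, h1, h2, h3, ha.symm, by simp [dist_adj ha.symm], h4, h5⟩
    · obtain ⟨x, c, h1, h2, h3, h4, h5, h6, h7⟩ := ih (G.dist u a) (by omega) hca rfl
      refine ⟨x, c, h1, h2, h3, h4, ?_, h6, h7⟩
      rcases dist_adj_cases hG h4 p with h | h
      · exact h
      · have e1 := dist_through hG h4 h5 h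
        have e2 := dist_through hG h4.symm (b := u) (a := a) (by omega) (by omega)
        have e3 := dist_tri hG p x u
        have e4 := dist_adj ha
        have := G.dist_comm (u := p) (v := x)
        have := dist_pos hG (a := x) (b := a) (by
          rintro rfl
          simp at h5)
        omega

end Dist

lemma succ_choose_two_mul_two (n : ℕ) : (n + 1).choose 2 * 2 = n * n + n := by
  induction n with
  | zero => rfl
  | succ n ih =>
    rw [Nat.choose_succ_succ', Nat.choose_one_right]
    ring_nf at *
    omega

section Lines

variable {V : Type*} {G : SimpleGraph V}

lemma mem_red {u v p : V} : p ∈ treeRedLine G u v ↔ Collin G u v p := by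
  have h1 := collin_left (G := G) u v
  have h2 := collin_right (G := G) u v
  simp only [treeRedLine, Set.mem_union, Set.mem_insert_iff, Set.mem_singleton_iff,
    Set.mem_ofPred_eq]
  grind

lemma mem_blue {u v p : V} : p ∈ treeBlueLine G u v ↔ p = u ∨ p = v ∨ ¬ Collin G u v p := by
  simp only [treeBlueLine, Set.mem_union, Set.mem_insert_iff, Set.mem_singleton_iff,
    Set.mem_ofPred_eq]
  tauto

lemma red_comm (u v : V) : treeRedLine G u v = treeRedLine G v u := by
  ext p
  rw [mem_red, mem_red, collin_comm]

lemma blue_comm (u v : V) : treeBlueLine G u v = treeBlueLine G v u := by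
  ext p
  rw [mem_blue, mem_blue, collin_comm]
  tauto

/-- The red line as a function of an unordered pair. -/
def redLine (G : SimpleGraph V) : Sym2 V → Set V := Sym2.lift ⟨treeRedLine G, red_comm⟩

/-- The blue line as a function of an unordered pair. -/
def blueLine (G : SimpleGraph V) : Sym2 V → Set V := Sym2.lift ⟨treeBlueLine G, blue_comm⟩

lemma exists_toward_forall (hG : G.IsTree) (a u : V) :
    ∃ e, ∀ c, G.Adj a c → c ≠ e → G.dist c u = G.dist a u + 1 := by
  by_cases h : a = u
  · subst h
    exact ⟨a, fun c hc _ => by simp [dist_adj hc.symm]⟩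
  · obtain ⟨e, he, hue⟩ := exists_adj_toward hG.connected h
    exact ⟨e, fun c hc hce => (dist_adj_cases hG hc u).resolve_left
      fun h' => hce (toward_unique hG hc h' he hue)⟩

lemma away_of_between (hG : G.IsTree) {x c u w : V} (hc : G.Adj x c)
    (hcu : G.dist c u = G.dist x u + 1) (hxu : x ≠ u)
    (h : G.dist x w = G.dist x u + G.dist u w) : G.dist c w = G.dist x w + 1 := by
  obtain ⟨e, he, heu⟩ := exists_adj_toward hG.connected hxu
  refine (dist_adj_cases hG hc w).resolve_left fun h' => ?_
  have h1 := dist_tri hG e u w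
  have h2 := dist_adj_cases hG he w
  obtain rfl := toward_unique hG hc h' he (by omega)
  omega

lemma exists_at_level (hG : G.IsTree) (l v : V) {i : ℕ} (hi : i ≤ G.dist l v) :
    ∃ w, G.dist l w = i ∧ G.dist l w + G.dist w v = G.dist l v := by
  induction hk : G.dist l v - i generalizing i with
  | zero => exact ⟨v, by omega, by simp⟩
  | succ k ih =>
    obtain ⟨w, hw, hwv⟩ := ih (i := i + 1) (by omega) (by omega)
    obtain ⟨z, hz, hzl⟩ := exists_adj_toward hG.connected (x := w) (p := l) (by
      rintro rfl
      simp at hw)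
    have h1 := dist_tri hG z w v
    have h2 := dist_tri hG l z v
    have h3 := dist_adj hz.symm
    have h4 := G.dist_comm (u := z) (v := l)
    have h5 := G.dist_comm (u := w) (v := l)
    exact ⟨z, by omega, by omega⟩

/-- `m` arranges the vertices in levels `0, …, q` such that all levels below `q` consist of
a single vertex, and adjacency means being on consecutive levels. -/
structure IsBroom (G : SimpleGraph V) (m : V → ℕ) (q : ℕ) : Prop where
  le : ∀ v, m v ≤ q
  ex : ∀ i < q, ∃ v, m v = i
  inj : ∀ u v, m u < q → m u = m v → u = v
  adj : ∀ u v, G.Adj u v ↔ m u + 1 = m v ∨ m v + 1 = m u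

lemma isBroom_of_levels (hG : G.IsTree) {l v : V} {q : ℕ} (hle : ∀ v, G.dist l v ≤ q)
    (hv : q ≤ G.dist l v + 1) (hinj : ∀ u v, G.dist l u < q → G.dist l u = G.dist l v → u = v) :
    IsBroom G (G.dist l) q where
  le := hle
  ex i hi := by
    obtain ⟨w, hw, -⟩ := exists_at_level hG l v (i := i) (by omega)
    exact ⟨w, hw⟩
  inj := hinj
  adj u v := by
    constructor
    · intro h
      have := dist_adj_cases hG h l
      have h4 := G.dist_comm (u := u) (v := l)
      have h5 := G.dist_comm (u := v) (v := l)
      omega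
    · have key : ∀ u v, G.dist l u + 1 = G.dist l v → G.Adj u v := by
        intro u v h
        obtain ⟨z, hz, hzl⟩ := exists_adj_toward hG.connected (x := v) (p := l) (by
          rintro rfl
          simp at h)
        rw [G.dist_comm, G.dist_comm (u := v)] at hzl
        have := hle v
        rw [hinj u z (by omega) (by omega)]
        exact hz.symm
      rintro (h | h)
      · exact key u v h
      · exact (key v u h).symm

lemma IsBroom.of_equiv {q n : ℕ} (e : V ≃ Fin n) (hqn : q ≤ n)
    (hadj : ∀ u v, G.Adj u v ↔ min (e u : ℕ) q + 1 = min (e v : ℕ) q ∨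
      min (e v : ℕ) q + 1 = min (e u : ℕ) q) :
    IsBroom G (fun v => min (e v : ℕ) q) q where
  le v := min_le_right _ _
  ex i hi := ⟨e.symm ⟨i, by omega⟩, by simp [hi.le]⟩
  inj u v hu huv := e.injective (Fin.ext (by omega))
  adj := hadj

namespace IsBroom

variable {m : V → ℕ} {q : ℕ}

lemma level_le (h : IsBroom G m q) (hG : G.IsTree) (u v : V) : m v ≤ m u + G.dist u v := by
  induction hk : G.dist u v generalizing u with
  | zero => rw [hG.connected.dist_eq_zero_iff.1 hk]; omega
  | succ k ih =>
    obtain ⟨c, hc, hcv⟩ := exists_adj_toward hG.connected (x := u) (p := v) (by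
      rintro rfl
      simp at hk)
    have := ih c (by omega)
    have := (h.adj u c).1 hc
    omega

lemma dist_le (h : IsBroom G m q) (hG : G.IsTree) {u v : V} (huv : m u < m v) :
    m u + G.dist u v ≤ m v := by
  induction hk : m v - m u generalizing u with
  | zero => omega
  | succ k ih =>
    by_cases h1 : m u + 1 = m v
    · rw [dist_adj ((h.adj u v).2 (Or.inl h1)), h1]
    · have := h.le v
      obtain ⟨w, hw⟩ := h.ex (m u + 1) (by omega)
      have h2 := ih (u := w) (by omega) (by omega)
      have h3 := dist_tri hG u w v
      have h4 := dist_adj ((h.adj u w).2 (Or.inl hw.symm))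
      omega

lemma dist_of_lt (h : IsBroom G m q) (hG : G.IsTree) {u v : V} (huv : m u < m v) :
    m u + G.dist u v = m v :=
  (h.dist_le hG huv).antisymm (h.level_le hG u v)

lemma dist_cases (h : IsBroom G m q) (hG : G.IsTree) (hq : 1 ≤ q) (u v : V) :
    (m u < m v ∧ m u + G.dist u v = m v) ∨ (m v < m u ∧ m v + G.dist u v = m u) ∨
    (u = v ∧ m u = m v ∧ G.dist u v = 0) ∨ (u ≠ v ∧ m u = q ∧ m v = q ∧ G.dist u v = 2) := by
  rcases lt_trichotomy (m u) (m v) with h1 | h1 | h1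
  · exact Or.inl ⟨h1, h.dist_of_lt hG h1⟩
  · by_cases huv : u = v
    · subst huv
      simp
    · have hu : m u = q := by
        by_contra hne
        exact huv (h.inj u v (lt_of_le_of_ne (h.le u) hne) h1)
      refine Or.inr (Or.inr (Or.inr ⟨huv, hu, h1 ▸ hu, ?_⟩))
      obtain ⟨x, hx⟩ := h.ex (q - 1) (by omega)
      have h2 := dist_tri hG u x v
      have h3 := dist_adj ((h.adj u x).2 (Or.inr (by omega)))
      have h4 := dist_adj ((h.adj x v).2 (Or.inl (by omega)))
      have h5 := dist_pos hG huv
      have h6 : G.dist u v ≠ 1 := fun h6 => by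
        have := (h.adj u v).1 (SimpleGraph.dist_eq_one_iff_adj.1 h6)
        omega
      omega
  · exact Or.inr (Or.inl ⟨h1, by rw [G.dist_comm, h.dist_of_lt hG h1]⟩)

lemma collin_of_lt (h : IsBroom G m q) (hG : G.IsTree) {u v : V} (hu : m u < q) (hv : m v < q)
    (p : V) : Collin G u v p := by
  have h1 := h.dist_cases hG (by omega) u v
  have h2 := h.dist_cases hG (by omega) u p
  have h3 := h.dist_cases hG (by omega) v p
  have h4 := G.dist_comm (u := u) (v := v)
  have h5 := G.dist_comm (u := v) (v := p)
  unfold Collin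
  omega

lemma collin_mixed_iff (h : IsBroom G m q) (hG : G.IsTree) {u v p : V} (hu : m u + 1 < q)
    (hv : m v = q) : Collin G u v p ↔ m p < q ∨ p = v := by
  have h0 := h.le p
  have h1 := h.dist_cases hG (by omega) u v
  have h2 := h.dist_cases hG (by omega) u p
  have h3 := h.dist_cases hG (by omega) v p
  have h4 := G.dist_comm (u := u) (v := v)
  have h5 := G.dist_comm (u := v) (v := p)
  by_cases hpv : p = v
  · simp [hpv, collin_right]
  · simp only [hpv, Ne.symm hpv, false_and, false_or, or_false] at h3 ⊢
    unfold Collin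
    omega

lemma collin_leaves_iff (h : IsBroom G m q) (hG : G.IsTree) (hq : 1 ≤ q) {u v p : V}
    (huv : u ≠ v) (hu : m u = q) (hv : m v = q) :
    Collin G u v p ↔ p = u ∨ p = v ∨ m p + 1 = q := by
  have h0 := h.le p
  have h1 := h.dist_cases hG hq u v
  have h2 := h.dist_cases hG hq u p
  have h3 := h.dist_cases hG hq v p
  have h4 := G.dist_comm (u := u) (v := v)
  have h5 := G.dist_comm (u := v) (v := p)
  by_cases hpu : p = u
  · simp [hpu, collin_left]
  by_cases hpv : p = v
  · simp [hpv, collin_right]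
  simp only [hpu, Ne.symm hpu, hpv, Ne.symm hpv, huv, false_and, false_or] at h1 h2 h3 ⊢
  unfold Collin
  omega

/-- Up to exchanging them, two distinct vertices of a broom are in one of four positions. -/
lemma pair_cases (h : IsBroom G m q) {P : V → V → Prop} (hP : ∀ u v, P u v → P v u)
    (h1 : ∀ u v, u ≠ v → m u < q → m v < q → P u v)
    (h2 : ∀ u v, m u + 1 < q → m v = q → P u v)
    (h3 : ∀ u v, m u + 1 = q → m v = q → P u v)
    (h4 : ∀ u v, u ≠ v → m u = q → m v = q → P u v) {u v : V} (huv : u ≠ v) : P u v := by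
  have key : ∀ u v, m u < q → m v = q → P u v := by
    intro u v hu hv
    rcases Nat.lt_or_ge (m u + 1) q with h | h
    · exact h2 u v h hv
    · exact h3 u v (by omega) hv
  rcases (h.le u).lt_or_eq with hu | hu <;> rcases (h.le v).lt_or_eq with hv | hv
  · exact h1 u v huv hu hv
  · exact key u v hu hv
  · exact hP _ _ (key v u hv hu)
  · exact h4 u v huv hu hv

end IsBroom

/-- `u` and `v` are the neighbours of `a` and `b` just beyond the path from `a` to `b`. -/
def Tight (G : SimpleGraph V) (a u b v : V) : Prop :=
  G.Adj a u ∧ G.Adj b v ∧ G.dist u v = G.dist a b + 2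

lemma Tight.symm {a u b v : V} (h : Tight G a u b v) : Tight G b v a u :=
  ⟨h.2.1, h.1, by rw [G.dist_comm, h.2.2, G.dist_comm]⟩

lemma Tight.dist_eq (hG : G.IsTree) {a u b v : V} (h : Tight G a u b v) :
    G.dist a v + 1 = G.dist u v := by
  have h1 := dist_tri hG u a v
  have h2 := dist_tri hG a b v
  have h3 := dist_adj h.1.symm
  have h4 := dist_adj h.2.1
  have := h.2.2
  omega

lemma Tight.left_unique (hG : G.IsTree) {a u b v a' b' : V} (h : Tight G a u b v)
    (h' : Tight G a' u b' v) : a = a' :=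
  toward_unique hG h.1.symm (h.dist_eq hG) h'.1.symm (h'.dist_eq hG)

lemma blue_eq_pair {u v : V} (h : ∀ p, Collin G u v p) : treeBlueLine G u v = {u, v} := by
  ext p
  simp [mem_blue, h p]

lemma blue_ne_pair {u v p a b : V} (huv : u ≠ v) (h : ¬ Collin G u v p) :
    treeBlueLine G u v ≠ {a, b} := by
  intro heq
  have h1 : u ∈ ({a, b} : Set V) := heq ▸ mem_blue.2 (Or.inl rfl)
  have h2 : v ∈ ({a, b} : Set V) := heq ▸ mem_blue.2 (Or.inr (Or.inl rfl))
  have h3 : p ∈ ({a, b} : Set V) := heq ▸ mem_blue.2 (Or.inr (Or.inr h))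
  have h4 : p ≠ u := by
    rintro rfl
    exact h (collin_left _ _)
  have h5 : p ≠ v := by
    rintro rfl
    exact h (collin_right _ _)
  simp only [Set.mem_insert_iff, Set.mem_singleton_iff] at h1 h2 h3
  grind

section

open scoped Classical

/-- The blue lines generated by two distinct elements of `s`. -/
noncomputable def blueIn (G : SimpleGraph V) (s : Finset V) : Finset (Set V) :=
  (s.offDiag.image Sym2.mk.uncurry).image (blueLine G)

lemma mem_blueIn {s : Finset V} {L : Set V} :
    L ∈ blueIn G s ↔ ∃ u ∈ s, ∃ v ∈ s, u ≠ v ∧ treeBlueLine G u v = L := by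
  simp only [blueIn, Finset.mem_image, Finset.mem_offDiag, Prod.exists]
  constructor
  · rintro ⟨_, ⟨u, v, ⟨hu, hv, huv⟩, rfl⟩, rfl⟩
    exact ⟨u, hu, v, hv, huv, rfl⟩
  · rintro ⟨u, hu, v, hv, huv, rfl⟩
    exact ⟨_, ⟨u, v, ⟨hu, hv, huv⟩, rfl⟩, rfl⟩

lemma card_blueIn {s : Finset V} (h : ∀ u ∈ s, ∀ v ∈ s, ∀ u' ∈ s, ∀ v' ∈ s, u ≠ v → u' ≠ v' →
    treeBlueLine G u v = treeBlueLine G u' v' → u = u' ∨ u = v') :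
    (blueIn G s).card = s.card.choose 2 := by
  rw [blueIn, Finset.card_image_of_injOn, Sym2.card_image_offDiag]
  intro a ha b hb hab
  simp only [Finset.coe_image, Set.mem_image, Finset.mem_coe, Finset.mem_offDiag,
    Prod.exists] at ha hb
  obtain ⟨u, v, ⟨hu, hv, huv⟩, rfl⟩ := ha
  obtain ⟨u', v', ⟨hu', hv', huv'⟩, rfl⟩ := hb
  change treeBlueLine G u v = treeBlueLine G u' v' at hab
  have h1 := h u hu v hv u' hu' v' hv' huv huv' hab
  have h2 := h v hv u hu u' hu' v' hv' huv.symm huv' (by rw [← hab, blue_comm])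
  change s(u, v) = s(u', v')
  rw [Sym2.eq_iff]
  grind

end

end Lines

noncomputable section

open scoped Classical

variable {V : Type*} [Fintype V] {G : SimpleGraph V}

lemma exists_third {a : V} (h : 3 ≤ G.degree a) (e f : V) : ∃ c, G.Adj a c ∧ c ≠ e ∧ c ≠ f := by
  have h1 : ({e, f} : Finset V).card < (G.neighborFinset a).card :=
    lt_of_le_of_lt Finset.card_le_two (by rw [G.card_neighborFinset_eq_degree]; omega)
  obtain ⟨c, hc, hc'⟩ := Finset.exists_mem_notMem_of_card_lt_card h1
  simp only [Finset.mem_insert, Finset.mem_singleton, not_or] at hc'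
  exact ⟨c, by simpa using hc, hc'⟩

lemma exists_second {a : V} (h : 2 ≤ G.degree a) (e : V) : ∃ c, G.Adj a c ∧ c ≠ e := by
  have h1 : ({e} : Finset V).card < (G.neighborFinset a).card := by
    rw [G.card_neighborFinset_eq_degree, Finset.card_singleton]
    omega
  obtain ⟨c, hc, hc'⟩ := Finset.exists_mem_notMem_of_card_lt_card h1
  exact ⟨c, by simpa using hc, by simpa using hc'⟩

lemma exists_away₂ (hG : G.IsTree) {a : V} (h : 3 ≤ G.degree a) (u v : V) :
    ∃ c, G.Adj a c ∧ G.dist c u = G.dist a u + 1 ∧ G.dist c v = G.dist a v + 1 := by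
  obtain ⟨e, he⟩ := exists_toward_forall hG a u
  obtain ⟨f, hf⟩ := exists_toward_forall hG a v
  obtain ⟨c, hc, hce, hcf⟩ := exists_third h e f
  exact ⟨c, hc, he c hc hce, hf c hc hcf⟩

lemma exists_away (hG : G.IsTree) {a : V} (h : 2 ≤ G.degree a) (u : V) :
    ∃ c, G.Adj a c ∧ G.dist c u = G.dist a u + 1 := by
  obtain ⟨e, he⟩ := exists_toward_forall hG a u
  obtain ⟨c, hc, hce⟩ := exists_second h e
  exact ⟨c, hc, he c hc hce⟩

lemma Tight.between (hG : G.IsTree) {a u b v u' v' : V} (h : Tight G a u b v)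
    (ha : 3 ≤ G.degree a) (hc : ∀ p, Collin G u v p ↔ Collin G u' v' p) :
    a ≠ u' ∧ a ≠ v' ∧ G.dist a u' + G.dist a v' = G.dist u' v' ∧
      (G.dist u u' + 1 = G.dist a u' ∨ G.dist u v' + 1 = G.dist a v') := by
  have h1 := h.dist_eq hG
  have h2 := dist_adj h.1
  have hau : a ≠ u := h.1.ne
  have h3 := h.2.2
  have hav : a ≠ v := by
    rintro rfl
    have := dist_adj h.1.symm
    have := dist_adj h.2.1.symm
    have := G.dist_comm (u := a) (v := b)
    omega
  have hb : G.dist a u + G.dist a v = G.dist u v := by omega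
  obtain ⟨c, hac, hcu, hcv⟩ := exists_away₂ hG ha u v
  have hn := not_collin_of_adj hG hac hau hav hb hcu hcv
  have hca := collin_of_between hb
  rw [hc] at hn hca
  obtain ⟨e1, e2, e3, -, -⟩ := between_of_adj hG hac hn hca
  refine ⟨e1, e2, e3, ?_⟩
  by_contra! hcon
  have hn' := not_collin_of_adj hG h.1 e1 e2 e3
    ((dist_adj_cases hG h.1 u').resolve_left hcon.1)
    ((dist_adj_cases hG h.1 v').resolve_left hcon.2)
  rw [← hc] at hn'
  exact hn' (collin_left _ _)

lemma Tight.on_path (hG : G.IsTree) {a u b v u' v' : V} (h : Tight G a u b v)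
    (ha : 3 ≤ G.degree a) (hc : ∀ p, Collin G u v p ↔ Collin G u' v' p) :
    G.dist u u' + G.dist u v' = G.dist u' v' := by
  obtain ⟨-, -, h1, h2⟩ := h.between hG ha hc
  have h3 := dist_adj_cases hG h.1 u'
  have h4 := dist_adj_cases hG h.1 v'
  have h5 := dist_tri hG u' u v'
  have := G.dist_comm (u := u) (v := u')
  omega

lemma Tight.eq_or_eq (hG : G.IsTree) {a u b v a' u' b' v' : V} (h : Tight G a u b v)
    (h' : Tight G a' u' b' v') (ha : 3 ≤ G.degree a) (hb : 3 ≤ G.degree b)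
    (ha' : 3 ≤ G.degree a') (hb' : 3 ≤ G.degree b')
    (hc : ∀ p, Collin G u v p ↔ Collin G u' v' p) :
    (u = u' ∧ v = v') ∨ (u = v' ∧ v = u') := by
  have hc' : ∀ p, Collin G v u p ↔ Collin G u' v' p := fun p => by rw [collin_comm, hc]
  have hd : ∀ p, Collin G u' v' p ↔ Collin G u v p := fun p => (hc p).symm
  have hd' : ∀ p, Collin G v' u' p ↔ Collin G u v p := fun p => by rw [collin_comm, hd]
  have e1 := h.on_path hG ha hc
  have e2 := h.symm.on_path hG hb hc'
  have e3 := h'.on_path hG ha' hd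
  have e4 := h'.symm.on_path hG hb' hd'
  have h1 := h.dist_eq hG
  have h2 := dist_adj h.1
  have c1 := G.dist_comm (u := u) (v := u')
  have c2 := G.dist_comm (u := u) (v := v')
  have c3 := G.dist_comm (u := v) (v := u')
  have c4 := G.dist_comm (u := v) (v := v')
  have hv : G.dist u v = G.dist a v + 1 := by omega
  obtain ⟨-, -, -, h3 | h3⟩ := h.between hG ha hc
  · left
    have t := dist_through hG h.1 (a := v) h3 hv
    have t' := dist_tri hG v u u'
    constructor
    · exact hG.connected.dist_eq_zero_iff.1 (by omega)
    · exact hG.connected.dist_eq_zero_iff.1 (by omega)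
  · right
    have t := dist_through hG h.1 (a := v) h3 hv
    constructor
    · exact hG.connected.dist_eq_zero_iff.1 (by omega)
    · exact hG.connected.dist_eq_zero_iff.1 (by omega)

/-- The vertices of degree at least three. -/
def branches (G : SimpleGraph V) : Finset V := {v | 3 ≤ G.degree v}

/-- The vertices of degree two. -/
def deg2 (G : SimpleGraph V) : Finset V := {v | G.degree v = 2}

@[simp] lemma mem_branches {v : V} : v ∈ branches G ↔ 3 ≤ G.degree v := by simp [branches]

@[simp] lemma mem_deg2 {v : V} : v ∈ deg2 G ↔ G.degree v = 2 := by simp [deg2]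

lemma degree_pos (hG : G.IsTree) (hn : 2 ≤ Fintype.card V) (v : V) : 1 ≤ G.degree v := by
  have : Nontrivial V := Fintype.one_lt_card_iff_nontrivial.1 (by omega)
  exact hG.connected.preconnected.degree_pos_of_nontrivial v

lemma sum_branches (hG : G.IsTree) (hn : 2 ≤ Fintype.card V) :
    (∑ a ∈ branches G, (G.degree a - 1)) + (deg2 G).card + 2 = Fintype.card V := by
  have h1 := G.sum_degrees_eq_twice_card_edges
  have h2 := hG.card_edgeFinset
  have h3 : ∑ v, G.degree v = ∑ v, ((G.degree v - 1) + 1) :=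
    Finset.sum_congr rfl fun v _ => by have := degree_pos hG hn v; omega
  have h4 : ∑ v, (G.degree v - 1) =
      ∑ v, ((if 3 ≤ G.degree v then G.degree v - 1 else 0) + if G.degree v = 2 then 1 else 0) :=
    Finset.sum_congr rfl fun v _ => by
      have := degree_pos hG hn v
      split_ifs <;> omega
  rw [Finset.sum_add_distrib] at h3
  rw [Finset.sum_add_distrib, ← Finset.sum_filter, ← Finset.card_filter] at h4
  change _ = ∑ a ∈ branches G, (G.degree a - 1) + (deg2 G).card at h4
  simp at h3
  omega

/-- The tight quadruples with branch vertices `a` and `b`. -/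
def tights (G : SimpleGraph V) (p : V × V) : Finset (V × V) := {q | Tight G p.1 q.1 p.2 q.2}

lemma card_tights_self (hG : G.IsTree) (a : V) :
    (G.degree a - 1) * (G.degree a - 1) + (G.degree a - 1) ≤ (tights G (a, a)).card := by
  have h : (G.neighborFinset a).offDiag ⊆ tights G (a, a) := by
    rintro ⟨u, v⟩ h
    simp only [Finset.mem_offDiag, SimpleGraph.mem_neighborFinset] at h
    obtain ⟨hu, hv, hne⟩ := h
    simp only [tights, Finset.mem_filter, Finset.mem_univ, true_and]
    refine ⟨hu, hv, ?_⟩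
    have h1 := dist_adj hu.symm
    have h2 := dist_adj hv.symm
    have h4 := dist_adj hv
    have h3 := dist_adj_cases hG hu v
    have h5 := dist_pos hG hne
    simp
    omega
  have h2 := Finset.card_le_card h
  rw [Finset.offDiag_card, G.card_neighborFinset_eq_degree] at h2
  refine le_trans ?_ h2
  rcases Nat.eq_zero_or_pos (G.degree a) with h0 | h0
  · simp [h0]
  · obtain ⟨k, hk⟩ := Nat.exists_eq_add_of_le' h0
    rw [hk]
    simp
    apply Nat.le_sub_of_add_le
    ring_nf
    omega

lemma card_away (hG : G.IsTree) (a b : V) :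
    G.degree a - 1 ≤ (Finset.univ.filter fun u =>
      G.Adj a u ∧ G.dist u b = G.dist a b + 1).card := by
  obtain ⟨e, he⟩ := exists_toward_forall hG a b
  rw [← G.card_neighborFinset_eq_degree]
  refine le_trans (Finset.pred_card_le_card_erase (a := e)) (Finset.card_le_card ?_)
  intro u hu
  simp only [Finset.mem_erase, SimpleGraph.mem_neighborFinset] at hu
  simpa using ⟨hu.2, he u hu.2 hu.1⟩

lemma card_tights_of_ne (hG : G.IsTree) {a b : V} (hab : a ≠ b) :
    (G.degree a - 1) * (G.degree b - 1) ≤ (tights G (a, b)).card := by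
  refine le_trans (Nat.mul_le_mul (card_away hG a b) (card_away hG b a)) ?_
  rw [← Finset.card_product]
  apply Finset.card_le_card
  rintro ⟨u, v⟩ h
  simp only [Finset.mem_product, Finset.mem_filter, Finset.mem_univ, true_and] at h
  obtain ⟨⟨h1, h2⟩, h3, h4⟩ := h
  simp only [tights, Finset.mem_filter, Finset.mem_univ, true_and]
  refine ⟨h1, h3, ?_⟩
  obtain ⟨e, he, heb⟩ := exists_adj_toward hG.connected hab
  have t1 := dist_through hG h1.symm (b := b) (a := u) (by
    have := G.dist_comm (u := u) (v := b)
    omega)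
  have c1 := dist_adj h1
  have c2 := dist_adj h3
  have := dist_tri hG u b v
  have c3 := G.dist_comm (u := u) (v := b)
  have c4 := G.dist_comm (u := a) (v := b)
  have c5 := G.dist_comm (u := a) (v := v)
  have c6 := G.dist_comm (u := a) (v := u)
  have c7 := G.dist_comm (u := u) (v := v)
  have h5 := dist_adj_cases hG h1 v
  have h6 : ¬ (G.dist u v + 1 = G.dist a v) := by
    intro h7
    have hev : G.dist e v + 1 = G.dist a v := by
      have := dist_tri hG e b v
      have := dist_adj_cases hG he v
      omega
    obtain rfl := toward_unique hG h1 h7 he hev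
    omega
  omega

lemma red_lower (hG : G.IsTree) (hn : 2 ≤ Fintype.card V) :
    1 + (Fintype.card V - (deg2 G).card - 1).choose 2 ≤ treeNumRed G := by
  set D := ∑ a ∈ branches G, (G.degree a - 1) with hD
  have hsum := sum_branches hG hn
  rw [← hD] at hsum
  set S := (branches G ×ˢ branches G).sigma (tights G) with hS
  let f : (Σ _ : V × V, V × V) → Set V := fun x => treeRedLine G x.2.1 x.2.2
  have hmem : ∀ x ∈ S, 3 ≤ G.degree x.1.1 ∧ 3 ≤ G.degree x.1.2 ∧
      Tight G x.1.1 x.2.1 x.1.2 x.2.2 := by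
    intro x hx
    simp only [hS, Finset.mem_sigma, Finset.mem_product, mem_branches, tights,
      Finset.mem_filter, Finset.mem_univ, true_and] at hx
    exact ⟨hx.1.1, hx.1.2, hx.2⟩
  have hcard : D * D + D ≤ S.card := by
    rw [hS, Finset.card_sigma, Finset.sum_product]
    have h1 : ∀ a ∈ branches G, (G.degree a - 1) * D + (G.degree a - 1) ≤
        ∑ b ∈ branches G, (tights G (a, b)).card := by
      intro a ha
      have h2 : ∑ b ∈ branches G, ((G.degree a - 1) * (G.degree b - 1) +
          if a = b then G.degree a - 1 else 0) = (G.degree a - 1) * D + (G.degree a - 1) := by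
        rw [Finset.sum_add_distrib, Finset.sum_ite_eq, if_pos ha, hD, Finset.mul_sum]
      rw [← h2]
      refine Finset.sum_le_sum fun b _ => ?_
      split_ifs with hab
      · subst hab
        exact card_tights_self hG a
      · exact card_tights_of_ne hG hab
    refine le_trans (le_of_eq ?_) (Finset.sum_le_sum h1)
    rw [Finset.sum_add_distrib, ← Finset.sum_mul]
  have hfib : S.card ≤ 2 * (S.image f).card := by
    refine Finset.card_le_mul_card_image S 2 fun L hL => ?_
    obtain ⟨x, hx, rfl⟩ := Finset.mem_image.1 hL
    obtain ⟨hxa, hxb, hxt⟩ := hmem x hx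
    refine le_trans (Finset.card_le_card (t := {x, ⟨(x.1.2, x.1.1), (x.2.2, x.2.1)⟩}) ?_)
      Finset.card_le_two
    intro y hy
    obtain ⟨hyS, hyx⟩ := Finset.mem_filter.1 hy
    obtain ⟨hya, hyb, hyt⟩ := hmem y hyS
    have hc : ∀ p, Collin G y.2.1 y.2.2 p ↔ Collin G x.2.1 x.2.2 p := fun p => by
      rw [← mem_red, ← mem_red]
      exact iff_of_eq (congrArg (p ∈ ·) hyx)
    obtain ⟨⟨a, b⟩, u, v⟩ := x
    obtain ⟨⟨a', b'⟩, u', v'⟩ := y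
    simp only at hxt hyt hxa hxb hya hyb hc
    simp only [Finset.mem_insert, Finset.mem_singleton]
    rcases hyt.eq_or_eq hG hxt hya hyb hxa hxb hc with ⟨rfl, rfl⟩ | ⟨rfl, rfl⟩
    · obtain rfl := hxt.left_unique hG hyt
      obtain rfl := hxt.symm.left_unique hG hyt.symm
      exact Or.inl rfl
    · obtain rfl := hxt.left_unique hG hyt.symm
      obtain rfl := hxt.symm.left_unique hG hyt
      exact Or.inr rfl
  have huniv : Set.univ ∉ S.image f := by
    intro h
    obtain ⟨x, hx, hxu⟩ := Finset.mem_image.1 h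
    obtain ⟨hxa, hxb, hxt⟩ := hmem x hx
    obtain ⟨c, hc, hcu, hcv⟩ := exists_away₂ hG hxa x.2.1 x.2.2
    have h1 := hxt.dist_eq hG
    have h2 := dist_adj hxt.1
    have h3 := dist_adj hxt.1.symm
    have h4 := dist_adj hxt.2.1.symm
    have hne : x.1.1 ≠ x.2.2 := by
      intro h
      have := hxt.2.2
      rw [← h] at this h4
      rw [G.dist_comm (u := x.1.1) (v := x.1.2)] at this
      omega
    have := not_collin_of_adj hG hc hxt.1.ne hne (by omega) hcu hcv
    rw [← mem_red] at this
    exact this (by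
      change c ∈ f x
      rw [hxu]
      trivial)
  have hsub : (↑(insert Set.univ (S.image f)) : Set (Set V)) ⊆ treeRedLines G := by
    intro L hL
    simp only [Finset.coe_insert, Set.mem_insert_iff, Finset.mem_coe] at hL
    rcases hL with rfl | hL
    · have : Nontrivial V := Fintype.one_lt_card_iff_nontrivial.1 (by omega)
      obtain ⟨v⟩ := hG.connected.nonempty
      obtain ⟨w, hw⟩ := hG.connected.preconnected.exists_adj_of_nontrivial v
      refine ⟨v, w, hw.ne, ?_⟩
      ext p
      simp [mem_red, collin_of_adj hG hw]
    · obtain ⟨x, hx, rfl⟩ := Finset.mem_image.1 hL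
      refine ⟨x.2.1, x.2.2, ?_, rfl⟩
      intro h
      have := (hmem x hx).2.2.2.2
      rw [h] at this
      simp at this
  have hle := Set.ncard_le_ncard hsub (Set.toFinite _)
  rw [Set.ncard_coe_finset, Finset.card_insert_of_notMem huniv] at hle
  have hD2 := succ_choose_two_mul_two D
  have : Fintype.card V - (deg2 G).card - 1 = D + 1 := by omega
  rw [this]
  change _ ≤ (treeRedLines G).ncard
  omega

/-- A blue line determines each of its generators that is not a leaf. -/
lemma blue_generator (hG : G.IsTree) {u v u' v' : V} (hu : 2 ≤ G.degree u) (huv : u ≠ v)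
    (hne : u' ≠ v') (h : treeBlueLine G u v = treeBlueLine G u' v') : u = u' ∨ u = v' := by
  by_contra! hcon
  have hB : ∀ p, (p = u ∨ p = v ∨ ¬ Collin G u v p) ↔ (p = u' ∨ p = v' ∨ ¬ Collin G u' v' p) :=
    fun p => by rw [← mem_blue, ← mem_blue, h]
  have h1 : ¬ Collin G u' v' u := by
    have := (hB u).1 (Or.inl rfl)
    tauto
  obtain ⟨e, hue, hev⟩ := exists_away hG hu v
  obtain ⟨f, huf, hfv⟩ := exists_adj_toward hG.connected huv
  have hce : Collin G u v e := by
    right; left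
    rw [G.dist_comm (u := v) (v := e), hev, dist_adj hue, G.dist_comm]
  have h2 : ¬ (e = u ∨ e = v ∨ ¬ Collin G u v e) := by
    rintro (rfl | rfl | h)
    · exact hue.ne rfl
    · simp at hev
    · exact h hce
  rw [hB] at h2
  push Not at h2
  obtain ⟨e1, e2, e3, e4, e5⟩ := between_of_adj hG hue.symm h1 h2.2.2
  have hef : e ≠ f := by
    rintro rfl
    omega
  have d1 : G.dist e f = 2 := by
    have h3 := dist_adj_cases hG hue f
    have h4 := dist_adj huf
    have h5 := dist_pos hG hef
    omega
  have d2 := (dist_adj_cases hG huf u').resolve_left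
    fun h => hef (toward_unique hG hue (by omega) huf h)
  have d3 := (dist_adj_cases hG huf v').resolve_left
    fun h => hef (toward_unique hG hue (by omega) huf h)
  have h3 := not_collin_of_hang hG e1 e2 hef e3 (p := f) (by omega) (by omega)
  have h4 : Collin G u v f := collin_of_between (by rw [dist_adj huf.symm]; omega)
  obtain rfl : f = v := by
    rcases (hB f).2 (Or.inr (Or.inr h3)) with h | h | h
    · exact absurd h huf.ne'
    · exact h
    · exact absurd h4 h
  have h5 := collin_of_adj hG huf
  have h6 := (hB u').2 (Or.inl rfl)
  have h7 := (hB v').2 (Or.inr (Or.inl rfl))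
  grind

lemma three_le_degree {z a b c : V} (ha : G.Adj z a) (hb : G.Adj z b) (hc : G.Adj z c)
    (hab : a ≠ b) (hac : a ≠ c) (hbc : b ≠ c) : 3 ≤ G.degree z := by
  rw [← G.card_neighborFinset_eq_degree, ← Finset.card_eq_three.2 ⟨a, b, c, hab, hac, hbc, rfl⟩]
  apply Finset.card_le_card
  intro y hy
  simp only [Finset.mem_insert, Finset.mem_singleton] at hy
  rcases hy with rfl | rfl | rfl <;> simpa

lemma exists_branch_between (hG : G.IsTree) {u v p : V} (h : ¬ Collin G u v p) :
    ∃ x, x ≠ u ∧ x ≠ v ∧ G.dist x u + G.dist x v = G.dist u v ∧ 3 ≤ G.degree x := by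
  obtain ⟨x, c, hxu, hxv, hx, hxc, -, hcu, hcv⟩ := exists_attach hG h
  refine ⟨x, hxu, hxv, hx, ?_⟩
  obtain ⟨e, he, heu⟩ := exists_adj_toward hG.connected hxu
  obtain ⟨f, hf, hfv⟩ := exists_adj_toward hG.connected hxv
  have hef : e ≠ f := by
    rintro rfl
    have := dist_tri hG u e v
    rw [G.dist_comm (u := u) (v := e)] at this
    omega
  have hec : e ≠ c := by
    rintro rfl
    omega
  have hfc : f ≠ c := by
    rintro rfl
    omega
  exact three_le_degree he hf hxc hef hec hfc

lemma exists_leaf_beyond (hG : G.IsTree) {x c : V} (h : G.Adj x c) :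
    ∃ l, G.degree l = 1 ∧ G.dist c l + 1 = G.dist x l := by
  obtain ⟨l, hl, hmax⟩ := Finset.exists_max_image
    (Finset.univ.filter fun p => G.dist c p + 1 = G.dist x p) (fun p => G.dist x p)
    ⟨c, by simp [dist_adj h]⟩
  simp only [Finset.mem_filter, Finset.mem_univ, true_and] at hl hmax
  refine ⟨l, ?_, hl⟩
  have hn : 2 ≤ Fintype.card V := Fintype.one_lt_card_iff.2 ⟨x, c, h.ne⟩
  have h1 := degree_pos hG hn l
  by_contra hne
  obtain ⟨e, he, hex⟩ := exists_away hG (a := l) (by omega) x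
  have h2 := dist_adj_cases hG h e
  have h3 := dist_tri hG c l e
  have h4 := dist_adj he
  have h5 := G.dist_comm (u := e) (v := x)
  have h6 := G.dist_comm (u := l) (v := x)
  have := hmax e (by omega)
  omega

/-- The first vertex of degree different from two on the way from `u` to `t`. -/
lemma exists_nearest (hG : G.IsTree) {u t : V} (ht : G.degree t ≠ 2) (hut : u ≠ t) :
    ∃ w, G.degree w ≠ 2 ∧ u ≠ w ∧ G.dist u w + G.dist w t = G.dist u t ∧
      ∀ p, Collin G u w p := by
  obtain ⟨w, hw, hmin⟩ := Finset.exists_min_image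
    (Finset.univ.filter fun w => G.degree w ≠ 2 ∧ u ≠ w ∧ G.dist u w + G.dist w t = G.dist u t)
    (fun w => G.dist u w) ⟨t, by simp [ht, hut]⟩
  simp only [Finset.mem_filter, Finset.mem_univ, true_and] at hw hmin
  refine ⟨w, hw.1, hw.2.1, hw.2.2, fun p => ?_⟩
  by_contra hp
  obtain ⟨x, hxu, hxw, hx, hdeg⟩ := exists_branch_between hG hp
  have h1 := dist_pos hG hxw
  have h2 := dist_tri hG x w t
  have h3 := dist_tri hG u x t
  have h4 := G.dist_comm (u := u) (v := x)
  have := hmin x ⟨by omega, hxu.symm, by omega⟩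
  omega

/-- The vertices of degree different from two. -/
def ends (G : SimpleGraph V) : Finset V := {v | G.degree v ≠ 2}

@[simp] lemma mem_ends {v : V} : v ∈ ends G ↔ G.degree v ≠ 2 := by simp [ends]

lemma card_ends_add_card_deg2 (G : SimpleGraph V) :
    (ends G).card + (deg2 G).card = Fintype.card V := by
  rw [add_comm]
  exact Finset.card_filter_add_card_filter_not _

/-- The blue lines generated by `u` and a vertex of degree different from two. -/
def blueFrom (G : SimpleGraph V) (u : V) : Finset (Set V) := (ends G).image (treeBlueLine G u)

lemma blue_lower (hG : G.IsTree) :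
    (deg2 G).card.choose 2 + ∑ u ∈ deg2 G, (blueFrom G u).card + (blueIn G (ends G)).card ≤
      treeNumBlue G := by
  have h1 : (blueIn G (deg2 G)).card = (deg2 G).card.choose 2 :=
    card_blueIn fun u hu v _ u' _ v' _ huv hne h =>
      blue_generator hG (mem_deg2.1 hu).ge huv hne h
  have h2 : ((deg2 G).biUnion (blueFrom G)).card = ∑ u ∈ deg2 G, (blueFrom G u).card := by
    refine Finset.card_biUnion fun u hu u' hu' _ => Finset.disjoint_left.2 fun L hL hL' => ?_
    simp only [blueFrom, Finset.mem_image, Finset.mem_coe, mem_ends, mem_deg2] at *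
    obtain ⟨v, hv, rfl⟩ := hL
    obtain ⟨v', hv', h⟩ := hL'
    have := blue_generator hG (u := u) (v := v) (by omega) (by grind) (by grind) h.symm
    grind
  have hd1 : Disjoint (blueIn G (deg2 G)) ((deg2 G).biUnion (blueFrom G)) := by
    refine Finset.disjoint_left.2 fun L hL hL' => ?_
    simp only [blueFrom, Finset.mem_image, mem_ends, mem_deg2, Finset.mem_biUnion,
      mem_blueIn] at *
    obtain ⟨a, ha, b, hb, hab, rfl⟩ := hL
    obtain ⟨u, hu, v, hv, h⟩ := hL'
    have huv : u ≠ v := by grind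
    have e1 := blue_generator hG (by omega) hab huv h.symm
    have e2 := blue_generator hG (by omega) hab.symm huv (by rw [blue_comm, h])
    grind
  have hd2 : Disjoint (blueIn G (deg2 G) ∪ (deg2 G).biUnion (blueFrom G)) (blueIn G (ends G)) := by
    refine Finset.disjoint_left.2 fun L hL hL' => ?_
    simp only [blueFrom, Finset.mem_image, mem_ends, mem_deg2, Finset.mem_biUnion,
      mem_blueIn, Finset.mem_union] at *
    obtain ⟨u', hu', v', hv', hne, rfl⟩ := hL'
    have : ∃ u v, G.degree u = 2 ∧ u ≠ v ∧ treeBlueLine G u v = treeBlueLine G u' v' := by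
      rcases hL with ⟨a, ha, b, hb, hab, h⟩ | ⟨u, hu, v, hv, h⟩
      · exact ⟨a, b, ha, hab, h⟩
      · exact ⟨u, v, hu, by grind, h⟩
    obtain ⟨u, v, hu, huv, h⟩ := this
    have := blue_generator hG (by omega) huv hne h
    grind
  rw [← h1, ← h2, ← Finset.card_union_of_disjoint hd1, ← Finset.card_union_of_disjoint hd2,
    ← Set.ncard_coe_finset]
  refine Set.ncard_le_ncard ?_ (Set.toFinite _)
  intro L hL
  simp only [blueFrom, Finset.mem_image, mem_ends, mem_deg2, Finset.mem_biUnion,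
      mem_blueIn, Finset.mem_union, Finset.mem_coe] at hL
  rcases hL with (⟨a, ha, b, hb, hab, h⟩ | ⟨u, hu, v, hv, h⟩) | ⟨a, ha, b, hb, hab, h⟩
  · exact ⟨a, b, hab, h.symm⟩
  · exact ⟨u, v, by grind, h.symm⟩
  · exact ⟨a, b, hab, h.symm⟩

lemma exists_hang (hG : G.IsTree) {u x c : V} (hx : 3 ≤ G.degree x) (hux : x ≠ u)
    (hc : G.Adj x c) (hcu : G.dist c u = G.dist x u + 1) :
    ∃ l p, G.degree l = 1 ∧ u ≠ l ∧ x ≠ l ∧ G.dist c l + 1 = G.dist x l ∧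
      G.dist u l = G.dist x u + G.dist x l ∧ G.Adj x p ∧ p ≠ c ∧
      G.dist p u = G.dist x u + 1 ∧ ¬ Collin G u l p := by
  obtain ⟨l, hl, hcl⟩ := exists_leaf_beyond hG hc
  have h1 := dist_through hG hc hcl hcu
  obtain ⟨p, hp, hpu, hpl⟩ := exists_away₂ hG hx u l
  have hxl : x ≠ l := by
    rintro rfl
    simp at hcl
  have h2 := dist_pos hG hxl
  refine ⟨l, p, hl, ?_, hxl, hcl, h1, hp, ?_, hpu,
    not_collin_of_adj hG hp hux hxl h1.symm hpu hpl⟩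
  · rintro rfl
    simp at h1
    omega
  · rintro rfl
    omega

/-- The two nearest vertices of degree different from two around a vertex of degree two. -/
lemma exists_two_nearest (hG : G.IsTree) {u : V} (hu : G.degree u = 2) :
    ∃ w w', G.degree w ≠ 2 ∧ G.degree w' ≠ 2 ∧ w ≠ w' ∧ u ≠ w ∧ u ≠ w' ∧
      (∀ p, Collin G u w p) ∧ ∀ p, Collin G u w' p := by
  have hnb : ∀ c, G.Adj u c → ∃ l w, G.dist c l + 1 = G.dist u l ∧ G.degree w ≠ 2 ∧ u ≠ w ∧
      G.dist u w + G.dist w l = G.dist u l ∧ ∀ p, Collin G u w p := by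
    intro c hc
    obtain ⟨l, hl, hcl⟩ := exists_leaf_beyond hG hc
    obtain ⟨w, hw⟩ := exists_nearest hG (u := u) (t := l) (by omega) (by
      rintro rfl
      simp at hcl)
    exact ⟨l, w, hcl, hw⟩
  obtain ⟨c, hc, -⟩ := exists_second hu.ge u
  obtain ⟨l, w, hcl, hw, huw, hwl, hcw⟩ := hnb c hc
  obtain ⟨c', hc', hne⟩ := exists_second hu.ge c
  obtain ⟨l', w', hcl', hw', huw', hwl', hcw'⟩ := hnb c' hc'
  refine ⟨w, w', hw, hw', ?_, huw, huw', hcw, hcw'⟩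
  rintro rfl
  have h1 : G.dist c' l = G.dist u l + 1 := (dist_adj_cases hG hc' l).resolve_left
    fun h => hne (toward_unique hG hc' h hc hcl)
  have h2 := dist_through hG hc' hcl' h1
  have h3 := dist_tri hG l w l'
  have h4 := G.dist_comm (u := l) (v := w)
  have h5 := dist_pos hG huw
  omega

lemma three_le_card_blueFrom (hG : G.IsTree) {u x : V} (hu : G.degree u = 2)
    (hx : 3 ≤ G.degree x) : 3 ≤ (blueFrom G u).card := by
  obtain ⟨w, w', hw, hw', hne, huw, huw', hcw, hcw'⟩ := exists_two_nearest hG hu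
  have hxu : x ≠ u := by
    rintro rfl
    omega
  obtain ⟨c, hc, hcu⟩ := exists_away hG (a := x) (by omega) u
  obtain ⟨l, p, hl, hul, -, -, -, -, -, -, hp⟩ := exists_hang hG hx hxu hc hcu
  have h1 : treeBlueLine G u w ≠ treeBlueLine G u w' := by
    rw [blue_eq_pair hcw, blue_eq_pair hcw']
    intro h
    have : w ∈ ({u, w'} : Set V) := h ▸ by simp
    simp only [Set.mem_insert_iff, Set.mem_singleton_iff] at this
    grind
  have h2 : treeBlueLine G u w ≠ treeBlueLine G u l := by
    rw [blue_eq_pair hcw]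
    exact (blue_ne_pair hul hp).symm
  have h3 : treeBlueLine G u w' ≠ treeBlueLine G u l := by
    rw [blue_eq_pair hcw']
    exact (blue_ne_pair hul hp).symm
  rw [← Finset.card_eq_three.2 ⟨_, _, _, h1, h2, h3, rfl⟩]
  apply Finset.card_le_card
  intro y hy
  simp only [Finset.mem_insert, Finset.mem_singleton] at hy
  rcases hy with rfl | rfl | rfl
  · exact Finset.mem_image_of_mem _ (mem_ends.2 hw)
  · exact Finset.mem_image_of_mem _ (mem_ends.2 hw')
  · exact Finset.mem_image_of_mem _ (mem_ends.2 (by omega))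

lemma exists_leaf (hG : G.IsTree) (hn : 2 ≤ Fintype.card V) : ∃ r, G.degree r = 1 := by
  have : Nontrivial V := Fintype.one_lt_card_iff_nontrivial.1 (by omega)
  exact hG.exists_vert_degree_one_of_nontrivial

/-- The two-element blue lines joining each vertex of degree different from two to the next
one on the way to a root. -/
lemma exists_pair_lines (hG : G.IsTree) (hn : 2 ≤ Fintype.card V) :
    ∃ P ⊆ blueIn G (ends G), P.card + 1 = (ends G).card ∧
      ∀ L ∈ P, ∃ a b, L = {a, b} := by
  obtain ⟨r, hr⟩ := exists_leaf hG hn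
  have hr' : G.degree r ≠ 2 := by omega
  have hpar : ∀ v, ∃ w, v ≠ r → G.degree w ≠ 2 ∧ v ≠ w ∧
      G.dist v w + G.dist w r = G.dist v r ∧ ∀ p, Collin G v w p := by
    intro v
    by_cases h : v = r
    · exact ⟨v, fun h' => (h' h).elim⟩
    · obtain ⟨w, hw⟩ := exists_nearest hG hr' h
      exact ⟨w, fun _ => hw⟩
  choose par hpar using hpar
  refine ⟨((ends G).erase r).image fun v => treeBlueLine G v (par v), ?_, ?_, ?_⟩
  · intro L hL
    simp only [Finset.mem_image, Finset.mem_erase] at hL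
    obtain ⟨v, ⟨hvr, hv⟩, rfl⟩ := hL
    obtain ⟨h1, h2, -⟩ := hpar v hvr
    exact mem_blueIn.2 ⟨v, hv, par v, by simpa using h1, h2, rfl⟩
  · rw [Finset.card_image_of_injOn, Finset.card_erase_add_one (by simpa using hr')]
    intro v hv v' hv' h
    simp only [Finset.coe_erase, Set.mem_sdiff, Set.mem_singleton_iff, Finset.mem_coe] at hv hv'
    obtain ⟨h1, h2, h3, h4⟩ := hpar v hv.2
    obtain ⟨h1', h2', h3', h4'⟩ := hpar v' hv'.2
    simp only [blue_eq_pair h4, blue_eq_pair h4'] at h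
    by_contra hne
    have e1 : v ∈ ({v', par v'} : Set V) := h ▸ by simp
    have e2 : v' ∈ ({v, par v} : Set V) := h ▸ by simp
    simp only [Set.mem_insert_iff, Set.mem_singleton_iff] at e1 e2
    have e3 := e1.resolve_left hne
    have e4 := e2.resolve_left (Ne.symm hne)
    rw [← e3] at h3'
    rw [← e4] at h3
    have := dist_pos hG hne
    have := dist_pos hG (Ne.symm hne)
    omega
  · intro L hL
    simp only [Finset.mem_image, Finset.mem_erase] at hL
    obtain ⟨v, ⟨hvr, hv⟩, rfl⟩ := hL
    exact ⟨v, par v, blue_eq_pair (hpar v hvr).2.2.2⟩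

lemma card_ends_le_card_blueIn (hG : G.IsTree) {x : V} (hx : 3 ≤ G.degree x)
    (hn : 2 ≤ Fintype.card V) : (ends G).card ≤ (blueIn G (ends G)).card := by
  obtain ⟨P, hP, hPc, hPp⟩ := exists_pair_lines hG hn
  obtain ⟨r, hr⟩ := exists_leaf hG hn
  have hxr : x ≠ r := by
    rintro rfl
    omega
  obtain ⟨c, hc, hcu⟩ := exists_away hG (a := x) (by omega) r
  obtain ⟨l, p, hl, hul, -, -, -, -, -, -, hp⟩ := exists_hang hG hx hxr hc hcu
  have hnot : treeBlueLine G r l ∉ P := fun h => by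
    obtain ⟨a, b, hab⟩ := hPp _ h
    exact blue_ne_pair hul hp hab
  rw [← hPc, ← Finset.card_insert_of_notMem hnot]
  refine Finset.card_le_card (Finset.insert_subset ?_ hP)
  exact mem_blueIn.2 ⟨r, mem_ends.2 (by omega), l, mem_ends.2 (by omega), hul, rfl⟩

lemma card_ends_lt_card_blueIn (hG : G.IsTree) {x u : V} (hx : 3 ≤ G.degree x)
    (hu : G.degree u = 2) (hn : 2 ≤ Fintype.card V) :
    (ends G).card + 1 ≤ (blueIn G (ends G)).card := by
  obtain ⟨P, hP, hPc, hPp⟩ := exists_pair_lines hG hn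
  have hxu : x ≠ u := by
    rintro rfl
    omega
  obtain ⟨e, he, hex⟩ := exists_away hG hu.ge x
  obtain ⟨w, hw, hew⟩ := exists_leaf_beyond hG he
  have hxw := dist_through hG he hew hex
  rw [G.dist_comm (u := u) (v := x)] at hxw
  obtain ⟨a, ha⟩ := exists_toward_forall hG x u
  obtain ⟨c, hc, hca, -⟩ := exists_third hx a a
  obtain ⟨c', hc', hca', hcc⟩ := exists_third hx a c
  have hcu := ha c hc hca
  have hcu' := ha c' hc' hca'
  have hcw := away_of_between hG hc hcu hxu hxw
  have hcw' := away_of_between hG hc' hcu' hxu hxw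
  obtain ⟨l, hl, hcl⟩ := exists_leaf_beyond hG hc
  obtain ⟨l', hl', hcl'⟩ := exists_leaf_beyond hG hc'
  have hlu := dist_through hG hc hcl hcu
  have hlu' := dist_through hG hc' hcl' hcu'
  have hlw := dist_through hG hc hcl hcw
  have hcl₂ := (dist_adj_cases hG hc l').resolve_left
    fun h => hcc (toward_unique hG hc' hcl' hc h)
  have hcl₂' := (dist_adj_cases hG hc' l).resolve_left
    fun h => hcc (toward_unique hG hc' h hc hcl)
  have hll := dist_through hG hc' hcl' hcl₂'
  have d0 := dist_pos hG hxu
  have hxl : x ≠ l := by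
    rintro rfl
    simp at hcl
  have hxl' : x ≠ l' := by
    rintro rfl
    simp at hcl'
  have d1 := dist_pos hG hxl
  have hxw' : x ≠ w := by
    rintro rfl
    simp at hxw
    omega
  have hll' : l ≠ l' := by
    rintro rfl
    simp at hll
    omega
  have hwl : w ≠ l := by
    rintro rfl
    simp at hlw
    omega
  have n1 : ¬ Collin G l l' u :=
    not_collin_of_hang hG hxl hxl' hxu hll.symm (by omega) (by omega)
  have n2 : ¬ Collin G w l c' := not_collin_of_adj hG hc' hxw' hxl hlw.symm hcw' hcl₂'
  have n3 : Collin G w l u := collin_of_between (by omega)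
  have hne : treeBlueLine G l l' ≠ treeBlueLine G w l := by
    intro h
    have h1 : u ∈ treeBlueLine G w l := h ▸ mem_blue.2 (Or.inr (Or.inr n1))
    rcases mem_blue.1 h1 with rfl | rfl | h1
    · simp at hew
    · simp at hlu
      omega
    · exact h1 n3
  have hn1 : treeBlueLine G l l' ∉ P := fun h => by
    obtain ⟨a, b, hab⟩ := hPp _ h
    exact blue_ne_pair hll' n1 hab
  have hn2 : treeBlueLine G w l ∉ P := fun h => by
    obtain ⟨a, b, hab⟩ := hPp _ h
    exact blue_ne_pair hwl n2 hab
  rw [← hPc, ← Finset.card_insert_of_notMem hn2,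
    ← Finset.card_insert_of_notMem (a := treeBlueLine G l l') (by simp [hne, hn1])]
  refine Finset.card_le_card (Finset.insert_subset ?_ (Finset.insert_subset ?_ hP))
  · exact mem_blueIn.2 ⟨l, mem_ends.2 (by omega), l', mem_ends.2 (by omega), hll', rfl⟩
  · exact mem_blueIn.2 ⟨w, mem_ends.2 (by omega), l, mem_ends.2 (by omega), hwl, rfl⟩

/-- The lower bound for trees with a branch vertex and a vertex of degree two. -/
lemma total_lower (hG : G.IsTree) {x u : V} (hx : 3 ≤ G.degree x) (hu : G.degree u = 2)
    (hn : 2 ≤ Fintype.card V) :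
    1 + (Fintype.card V - (deg2 G).card - 1).choose 2 + ((deg2 G).card + 2).choose 2 +
      Fintype.card V + ∑ u ∈ deg2 G, ((blueFrom G u).card - 3) ≤
      treeNumRed G + treeNumBlue G := by
  have h1 := red_lower hG hn
  have h2 := blue_lower hG
  have h3 := card_ends_lt_card_blueIn hG hx hu hn
  have h4 := card_ends_add_card_deg2 G
  have h5 : ∑ u ∈ deg2 G, (blueFrom G u).card =
      ∑ u ∈ deg2 G, ((blueFrom G u).card - 3) + 3 * (deg2 G).card := by
    rw [mul_comm, ← smul_eq_mul, ← Finset.sum_const, ← Finset.sum_add_distrib]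
    refine Finset.sum_congr rfl fun v hv => ?_
    have := three_le_card_blueFrom hG (mem_deg2.1 hv) hx
    omega
  have h6 : ((deg2 G).card + 2).choose 2 = (deg2 G).card.choose 2 + 2 * (deg2 G).card + 1 := by
    simp only [Nat.choose_succ_succ', Nat.choose_zero_right, Nat.choose_one_right, Nat.reduceAdd]
    omega
  omega

/-- The lower bound for trees without vertices of degree two. -/
lemma total_lower_of_no_deg2 (hG : G.IsTree) {x : V} (hx : 3 ≤ G.degree x)
    (h : deg2 G = ∅) (hn : 2 ≤ Fintype.card V) :
    1 + (Fintype.card V - 1).choose 2 + Fintype.card V ≤ treeNumRed G + treeNumBlue G := by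
  have h1 := red_lower hG hn
  have h2 := blue_lower hG
  have h3 := card_ends_le_card_blueIn hG hx hn
  have h4 := card_ends_add_card_deg2 G
  simp only [h, Finset.card_empty, Nat.sub_zero, add_zero] at h1 h4
  omega

lemma leaf_unique {c y e : V} (h : G.degree c = 1) (hy : G.Adj c y) (he : G.Adj c e) : y = e :=
  (SimpleGraph.degree_eq_one_iff_existsUnique_adj.1 h).unique hy he

lemma leaf_dist (hG : G.IsTree) {c y z : V} (h : G.degree c = 1) (hy : G.Adj y c) (hz : c ≠ z) :
    G.dist y z + 1 = G.dist c z := by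
  obtain ⟨e, he, hez⟩ := exists_adj_toward hG.connected hz
  rwa [leaf_unique h hy.symm he]

lemma blue_eq_of_card_blueFrom (hG : G.IsTree) {u v v' p p' : V} (hu : G.degree u = 2)
    (hB : (blueFrom G u).card ≤ 3) (hv : G.degree v ≠ 2) (hv' : G.degree v' ≠ 2)
    (h : ¬ Collin G u v p) (h' : ¬ Collin G u v' p') :
    treeBlueLine G u v = treeBlueLine G u v' := by
  obtain ⟨w, w', hw, hw', hne, huw, huw', hcw, hcw'⟩ := exists_two_nearest hG hu
  have huv : u ≠ v := by
    rintro rfl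
    exact hv hu
  have huv' : u ≠ v' := by
    rintro rfl
    exact hv' hu
  by_contra hcon
  have h1 : treeBlueLine G u w ≠ treeBlueLine G u w' := by
    rw [blue_eq_pair hcw, blue_eq_pair hcw']
    intro h
    have : w ∈ ({u, w'} : Set V) := h ▸ by simp
    simp only [Set.mem_insert_iff, Set.mem_singleton_iff] at this
    grind
  have h2 : treeBlueLine G u w ≠ treeBlueLine G u v :=
    blue_eq_pair hcw ▸ (blue_ne_pair huv h).symm
  have h3 : treeBlueLine G u w' ≠ treeBlueLine G u v :=
    blue_eq_pair hcw' ▸ (blue_ne_pair huv h).symm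
  have h4 : treeBlueLine G u w ≠ treeBlueLine G u v' :=
    blue_eq_pair hcw ▸ (blue_ne_pair huv' h').symm
  have h5 : treeBlueLine G u w' ≠ treeBlueLine G u v' :=
    blue_eq_pair hcw' ▸ (blue_ne_pair huv' h').symm
  have h6 : ({treeBlueLine G u w, treeBlueLine G u w', treeBlueLine G u v,
      treeBlueLine G u v'} : Finset (Set V)).card = 4 :=
    Finset.card_eq_of_equiv_fin (by
      refine (Fintype.equivFinOfCardEq ?_)
      rw [Fintype.card_coe, Finset.card_insert_of_notMem, Finset.card_eq_three.2
        ⟨_, _, _, h3, h5, hcon, rfl⟩]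
      simp [h1, h2, h4])
  have h7 : ({treeBlueLine G u w, treeBlueLine G u w', treeBlueLine G u v,
      treeBlueLine G u v'} : Finset (Set V)) ⊆ blueFrom G u := by
    intro y hy
    simp only [Finset.mem_insert, Finset.mem_singleton] at hy
    rcases hy with rfl | rfl | rfl | rfl
    · exact Finset.mem_image_of_mem _ (mem_ends.2 hw)
    · exact Finset.mem_image_of_mem _ (mem_ends.2 hw')
    · exact Finset.mem_image_of_mem _ (mem_ends.2 hv)
    · exact Finset.mem_image_of_mem _ (mem_ends.2 hv')
  have := Finset.card_le_card h7
  omega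

lemma degree_eq_one_of_away (hG : G.IsTree) {u x c : V} (hu : G.degree u = 2)
    (hB : (blueFrom G u).card ≤ 3) (hx : 3 ≤ G.degree x) (hc : G.Adj x c)
    (hcu : G.dist c u = G.dist x u + 1) : G.degree c = 1 := by
  have hxu : x ≠ u := by
    rintro rfl
    omega
  obtain ⟨l, p, hl, hul, hxl, hcl, hd, hp, hpc, hpu, hcol⟩ := exists_hang hG hx hxu hc hcu
  obtain ⟨l', hl', hpl'⟩ := exists_leaf_beyond hG hp
  have hxl' : x ≠ l' := by
    rintro rfl
    simp at hpl'
  have hcl' := (dist_adj_cases hG hc l').resolve_left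
    fun h => hpc (toward_unique hG hp hpl' hc h)
  have h1 := dist_through hG hp hpl' hpu
  have h2 : ¬ Collin G u l' c := not_collin_of_adj hG hc hxu hxl' h1.symm hcu hcl'
  have h3 := blue_eq_of_card_blueFrom hG hu hB (v := l) (v' := l') (by omega) (by omega) hcol h2
  have h4 : c ∈ treeBlueLine G u l := h3 ▸ mem_blue.2 (Or.inr (Or.inr h2))
  rcases mem_blue.1 h4 with rfl | rfl | h4
  · simp at hcu
  · exact hl
  · exact absurd (collin_of_between (by omega)) h4

lemma collin_of_two_branches (hG : G.IsTree) {u x y c c' p p' : V} (hu : G.degree u = 2)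
    (hB : (blueFrom G u).card ≤ 3) (hx : 3 ≤ G.degree x) (hc : G.Adj x c) (hc' : G.Adj y c')
    (hcu : G.dist c u = G.dist x u + 1) (hcl : G.degree c = 1)
    (hcl' : G.degree c' = 1) (hp : ¬ Collin G u c p) (hp' : ¬ Collin G u c' p')
    (hcu' : G.dist c' u = G.dist y u + 1) :
    G.dist u x + G.dist u y = G.dist x y ∨ G.dist u x + G.dist x y = G.dist u y := by
  have hxu : x ≠ u := by
    rintro rfl
    omega
  have h1 := blue_eq_of_card_blueFrom hG hu hB (v := c) (v' := c') (by omega) (by omega) hp hp'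
  have h2 : Collin G u c' x := by
    by_contra h
    have h3 : x ∈ treeBlueLine G u c := h1 ▸ mem_blue.2 (Or.inr (Or.inr h))
    rcases mem_blue.1 h3 with h3 | h3 | h3
    · exact hxu h3
    · exact hc.ne h3
    · exact h3 (collin_of_between (by rw [G.dist_comm (u := u) (v := c), hcu, dist_adj hc]))
  have hxc : c' ≠ x := by
    rintro rfl
    omega
  have h3 := leaf_dist hG hcl' hc' hxc
  have h4 := dist_tri hG u y x
  have := G.dist_comm (u := u) (v := x)
  have := G.dist_comm (u := u) (v := y)
  have := G.dist_comm (u := u) (v := c')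
  have := G.dist_comm (u := x) (v := y)
  have := G.dist_comm (u := x) (v := c')
  rcases h2 with h | h | h <;> omega

lemma branch_unique (hG : G.IsTree) {u x y : V} (hu : G.degree u = 2)
    (hB : (blueFrom G u).card ≤ 3) (hx : 3 ≤ G.degree x) (hy : 3 ≤ G.degree y) : x = y := by
  by_contra hne
  have hxu : x ≠ u := by
    rintro rfl
    omega
  have hyu : y ≠ u := by
    rintro rfl
    omega
  have key : ∀ z, 3 ≤ G.degree z → z ≠ u → ∃ c p, G.Adj z c ∧ G.degree c = 1 ∧
      G.dist c u = G.dist z u + 1 ∧ G.Adj z p ∧ p ≠ c ∧ G.dist p u = G.dist z u + 1 ∧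
      ¬ Collin G u c p := by
    intro z hz hzu
    obtain ⟨c, hc, hcu⟩ := exists_away hG (a := z) (by omega) u
    have hc1 := degree_eq_one_of_away hG hu hB hz hc hcu
    obtain ⟨l, p, hl, hul, hzl, hcl, hd, hp, hpc, hpu, hcol⟩ := exists_hang hG hz hzu hc hcu
    obtain rfl : c = l := by
      by_contra hcl'
      have := leaf_dist hG hc1 hc hcl'
      omega
    exact ⟨c, p, hc, hc1, hcu, hp, hpc, hpu, hcol⟩
  obtain ⟨c, p, hc, hc1, hcu, hp, hpc, hpu, hcol⟩ := key x hx hxu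
  obtain ⟨c', p', hc', hc1', hcu', hp', hpc', hpu', hcol'⟩ := key y hy hyu
  have e1 := collin_of_two_branches hG hu hB hx hc hc' hcu hc1 hc1' hcol hcol' hcu'
  have e2 := collin_of_two_branches hG hu hB hy hc' hc hcu' hc1' hc1 hcol' hcol hcu
  have d1 := dist_pos hG hxu
  have d2 := dist_pos hG hyu
  have d3 := dist_pos hG hne
  have c1 := G.dist_comm (u := u) (v := x)
  have c2 := G.dist_comm (u := u) (v := y)
  have c3 := G.dist_comm (u := x) (v := y)
  have h1 : G.dist x y = G.dist x u + G.dist u y := by omega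
  have h2 := away_of_between hG hp hpu hxu h1
  have hpc1 : p ≠ c' := by
    rintro rfl
    exact hne (toward_unique hG hp.symm hpu.symm hc'.symm hcu'.symm)
  have h3 := degree_eq_one_of_away hG hu hB hx hp hpu
  have hpy : c' ≠ p := hpc1.symm
  have h4 := leaf_dist hG hc1' hc' hpy
  have h5 := blue_eq_of_card_blueFrom hG hu hB (v := c) (v' := c') (by omega) (by omega) hcol hcol'
  have h6 : p ∈ treeBlueLine G u c' := h5 ▸ mem_blue.2 (Or.inr (Or.inr hcol))
  rcases mem_blue.1 h6 with h | h | h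
  · subst h
    simp at hpu
  · exact hpc1 h
  · apply h
    right; left
    have := G.dist_comm (u := u) (v := p)
    have := G.dist_comm (u := y) (v := p)
    omega

lemma level_unique (hG : G.IsTree) {l : V} (hl : G.degree l = 1) {M : ℕ}
    (h : ∀ p, G.dist l p < M → G.degree p ≤ 2) {u v : V} (huv : G.dist l u = G.dist l v)
    (hu : G.dist l u ≤ M) : u = v := by
  induction hi : G.dist l u generalizing u v with
  | zero =>
    rw [← hG.connected.dist_eq_zero_iff.1 hi]
    exact hG.connected.dist_eq_zero_iff.1 (huv.symm.trans hi)
  | succ i ih =>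
    obtain ⟨z, hz, hzl⟩ := exists_adj_toward hG.connected (x := u) (p := l) (by
      rintro rfl
      simp at hi)
    obtain ⟨z', hz', hzl'⟩ := exists_adj_toward hG.connected (x := v) (p := l) (by
      rintro rfl
      simp [hi] at huv)
    rw [G.dist_comm, G.dist_comm (u := u)] at hzl
    rw [G.dist_comm, G.dist_comm (u := v)] at hzl'
    obtain rfl := ih (u := z) (v := z') (by omega) (by omega) (by omega)
    by_contra hne
    by_cases hzz : z = l
    · subst hzz
      exact hne (leaf_unique hl hz.symm hz'.symm)
    · obtain ⟨e, he, hel⟩ := exists_adj_toward hG.connected hzz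
      rw [G.dist_comm, G.dist_comm (u := z)] at hel
      have := three_le_degree he hz.symm hz'.symm (by rintro rfl; omega)
        (by rintro rfl; omega) hne
      have := h z (by omega)
      omega

lemma exists_isBroom (hG : G.IsTree) {u x : V} (hu : G.degree u = 2)
    (hB : (blueFrom G u).card ≤ 3) (hx : 3 ≤ G.degree x) :
    ∃ m q, 2 ≤ q ∧ IsBroom G m q ∧ m x + 1 = q := by
  obtain ⟨e, he, hex⟩ := exists_away hG hu.ge x
  obtain ⟨l, hl, hel⟩ := exists_leaf_beyond hG he
  have hxl := dist_through hG he hel hex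
  have hxu : x ≠ u := by
    rintro rfl
    omega
  have h0 := dist_pos hG hxu
  have h1 := G.dist_comm (u := u) (v := x)
  have h2 := G.dist_comm (u := x) (v := l)
  have hinj : ∀ {a b}, G.dist l a = G.dist l b → G.dist l a ≤ G.dist l x → a = b :=
    fun hab ha => level_unique hG hl (fun p hp => by
      by_contra! h
      rw [branch_unique hG hu hB h hx] at hp
      omega) hab ha
  refine ⟨G.dist l, G.dist l x + 1, by omega, isBroom_of_levels hG (v := x) (fun v => ?_)
    (by omega) fun a b ha hab => hinj hab (by omega), rfl⟩
  by_contra! hv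
  obtain ⟨w, hw, hwv⟩ := exists_at_level hG l v (i := G.dist l x) (by omega)
  obtain rfl := hinj hw hw.le
  have hwv' : w ≠ v := by
    rintro rfl
    omega
  obtain ⟨c, hc, hcv⟩ := exists_adj_toward hG.connected hwv'
  have h3 := dist_tri hG l c v
  have h4 := dist_tri hG c u l
  have h5 := G.dist_comm (u := l) (v := c)
  have hcu := (dist_adj_cases hG hc u).resolve_left (by omega)
  have hc1 := degree_eq_one_of_away hG hu hB hx hc hcu
  have hcv' : c ≠ v := by
    rintro rfl
    simp at hcv
    omega
  have := leaf_dist hG hc1 hc hcv'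
  omega

namespace IsBroom

variable {m : V → ℕ} {q : ℕ}

/-- The number of vertices on the levels below `q`. -/
lemma card_below (h : IsBroom G m q) : (Finset.univ.filter fun v => m v < q).card = q := by
  rw [← Finset.card_range q]
  refine Finset.card_nbij m ?_ ?_ ?_
  · intro v hv
    simpa using hv
  · intro v hv w _ hvw
    exact h.inj v w (by simpa using hv) hvw
  · intro i hi
    obtain ⟨v, rfl⟩ := h.ex i (by simpa using hi)
    exact ⟨v, by simpa using hi, rfl⟩

lemma card_eq (h : IsBroom G m q) :
    Fintype.card V = q + (Finset.univ.filter fun v => m v = q).card := by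
  have h2 := Finset.card_filter_add_card_filter_not (s := (Finset.univ : Finset V))
    (fun v => m v < q)
  rw [h.card_below, Finset.card_univ] at h2
  rw [← h2]
  congr 2
  ext v
  have := h.le v
  simp
  omega

lemma exists_equiv (h : IsBroom G m q) {p : ℕ} (hp : Fintype.card V = q + p) :
    ∃ e : V ≃ Fin (q + p), ∀ v, min (e v : ℕ) q = m v := by
  have h1 : Fintype.card {v // ¬ m v < q} = p := by
    rw [Fintype.card_subtype]
    have := h.card_eq
    have h2 : (Finset.univ.filter fun v => ¬ m v < q) = Finset.univ.filter fun v => m v = q := by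
      ext v
      have := h.le v
      simp
      omega
    rw [h2]
    omega
  let e1 : {v // m v < q} ≃ Fin q := Equiv.ofBijective (fun v => ⟨m v, v.2⟩)
    ⟨fun v w hvw => Subtype.ext (h.inj v w v.2 (by simpa using hvw)), fun i => by
      obtain ⟨v, hv⟩ := h.ex i i.2
      exact ⟨⟨v, hv ▸ i.2⟩, Fin.ext hv⟩⟩
  let e2 : {v // ¬ m v < q} ≃ Fin p := Fintype.equivFinOfCardEq h1
  refine ⟨(Equiv.sumCompl fun v => m v < q).symm.trans ((e1.sumCongr e2).trans finSumFinEquiv),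
    fun v => ?_⟩
  by_cases hv : m v < q
  · simp [Equiv.sumCompl_symm_apply_of_pos, hv, e1]
    rfl
  · have := h.le v
    simp [Equiv.sumCompl_symm_apply_of_neg, hv]
    omega

lemma numRed_le (h : IsBroom G m q) (hG : G.IsTree) (hq : 1 ≤ q) {p : ℕ}
    (hp : Fintype.card V = q + p) : treeNumRed G ≤ 1 + p + p.choose 2 := by
  obtain ⟨L, hL⟩ : ∃ L : Finset V, L = Finset.univ.filter fun v => m v = q := ⟨_, rfl⟩
  have hLc : L.card = p := by
    have := h.card_eq
    rw [← hL] at this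
    omega
  obtain ⟨S, hS⟩ : ∃ S : Finset (Set V), S =
      ({Set.univ} ∪ L.image fun v => {p | m p < q ∨ p = v}) ∪
      (L.offDiag.image Sym2.mk.uncurry).image (redLine G) := ⟨_, rfl⟩
  have hmem : ∀ T, T ∈ S ↔ (T = Set.univ ∨ ∃ v, m v = q ∧ {p | m p < q ∨ p = v} = T) ∨
      ∃ u v, m u = q ∧ m v = q ∧ u ≠ v ∧ treeRedLine G u v = T := by
    intro T
    simp only [hS, hL, Finset.mem_union, Finset.mem_singleton, Finset.mem_image,
      Finset.mem_offDiag, Prod.exists, Finset.mem_filter, Finset.mem_univ, true_and]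
    refine or_congr_right ⟨?_, ?_⟩
    · rintro ⟨_, ⟨u, v, ⟨hu, hv, huv⟩, rfl⟩, rfl⟩
      exact ⟨u, v, hu, hv, huv, rfl⟩
    · rintro ⟨u, v, hu, hv, huv, rfl⟩
      exact ⟨_, ⟨u, v, ⟨hu, hv, huv⟩, rfl⟩, rfl⟩
  have h1 : treeRedLines G ⊆ S := by
    rintro _ ⟨u, v, huv, rfl⟩
    refine h.pair_cases (P := fun u v => treeRedLine G u v ∈ S) (fun u v => ?_)
      (fun u v _ hu hv => ?_) (fun u v hu hv => ?_) (fun u v hu hv => ?_)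
      (fun u v huv hu hv => ?_) huv
    · rw [red_comm]
      exact id
    · refine (hmem _).2 (Or.inl (Or.inl (Set.eq_univ_of_forall fun p => ?_)))
      exact mem_red.2 (h.collin_of_lt hG hu hv p)
    · refine (hmem _).2 (Or.inl (Or.inr ⟨v, hv, ?_⟩))
      ext p
      rw [mem_red, h.collin_mixed_iff hG hu hv]
      rfl
    · refine (hmem _).2 (Or.inl (Or.inl (Set.eq_univ_of_forall fun p => ?_)))
      exact mem_red.2 (collin_of_adj hG ((h.adj u v).2 (Or.inl (by omega))) p)
    · exact (hmem _).2 (Or.inr ⟨u, v, hu, hv, huv, rfl⟩)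
  calc treeNumRed G ≤ S.card := Set.ncard_coe_finset S ▸ Set.ncard_le_ncard h1
    _ ≤ _ := by
      rw [hS]
      refine (Finset.card_union_le _ _).trans (add_le_add ((Finset.card_union_le _ _).trans
        (add_le_add ?_ ?_)) ?_)
      · simp
      · exact hLc ▸ Finset.card_image_le
      · rw [← hLc, ← Sym2.card_image_offDiag]
        exact Finset.card_image_le

lemma numBlue_le (h : IsBroom G m q) (hG : G.IsTree) (hq : 1 ≤ q) {p : ℕ}
    (hp : Fintype.card V = q + p) : treeNumBlue G ≤ q.choose 2 + p + q := by
  obtain ⟨L, hL⟩ : ∃ L : Finset V, L = Finset.univ.filter fun v => m v = q := ⟨_, rfl⟩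
  have hLc : L.card = p := by
    have := h.card_eq
    rw [← hL] at this
    omega
  obtain ⟨x, hx⟩ := h.ex (q - 1) (by omega)
  obtain ⟨P, hP⟩ : ∃ P : Finset V, P = Finset.univ.filter fun v => m v < q := ⟨_, rfl⟩
  have hPc : P.card = q := hP ▸ h.card_below
  have hxP : x ∈ P := by
    simp [hP, hx]
    omega
  obtain ⟨S, hS⟩ : ∃ S : Finset (Set V), S = ((blueIn G P ∪ L.image (treeBlueLine G x)) ∪
      (P.erase x).image fun u => {p | p = u ∨ m p = q}) ∪ {{p | p ≠ x}} := ⟨_, rfl⟩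
  have hmem : ∀ T, T ∈ S ↔ (((∃ u, m u < q ∧ ∃ v, m v < q ∧ u ≠ v ∧ treeBlueLine G u v = T) ∨
      ∃ v, m v = q ∧ treeBlueLine G x v = T) ∨
      ∃ u, (u ≠ x ∧ m u < q) ∧ {p | p = u ∨ m p = q} = T) ∨ T = {p | p ≠ x} := by
    intro T
    simp only [hS, hL, hP, Finset.mem_union, Finset.mem_singleton, Finset.mem_image,
      mem_blueIn, Finset.mem_erase, Finset.mem_filter, Finset.mem_univ, true_and]
  have h1 : treeBlueLines G ⊆ S := by
    rintro _ ⟨u, v, huv, rfl⟩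
    refine h.pair_cases (P := fun u v => treeBlueLine G u v ∈ S) (fun u v => ?_)
      (fun u v huv hu hv => ?_) (fun u v hu hv => ?_) (fun u v hu hv => ?_)
      (fun u v huv hu hv => ?_) huv
    · rw [blue_comm]
      exact id
    · exact (hmem _).2 (Or.inl (Or.inl (Or.inl ⟨u, hu, v, hv, huv, rfl⟩)))
    · refine (hmem _).2 (Or.inl (Or.inr ⟨u, ⟨?_, by omega⟩, ?_⟩))
      · rintro rfl
        omega
      · ext p
        have := h.le p
        rw [mem_blue, h.collin_mixed_iff hG hu hv, Set.mem_ofPred_eq]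
        grind
    · refine (hmem _).2 (Or.inl (Or.inl (Or.inr ⟨v, hv, ?_⟩)))
      rw [h.inj x u (by omega) (by omega)]
    · refine (hmem _).2 (Or.inr ?_)
      ext p
      have h2 := h.inj p x
      rw [mem_blue, h.collin_leaves_iff hG hq huv hu hv, Set.mem_ofPred_eq]
      grind
  calc treeNumBlue G ≤ S.card := Set.ncard_coe_finset S ▸ Set.ncard_le_ncard h1
    _ ≤ q.choose 2 + p + (q - 1) + 1 := by
      rw [hS]
      refine (Finset.card_union_le _ _).trans (add_le_add ((Finset.card_union_le _ _).trans
        (add_le_add ((Finset.card_union_le _ _).trans (add_le_add ?_ ?_)) ?_)) ?_)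
      · rw [← hPc, ← Sym2.card_image_offDiag]
        exact Finset.card_image_le
      · exact hLc ▸ Finset.card_image_le
      · nth_rw 2 [← hPc]
        rw [← Finset.card_erase_of_mem hxP]
        exact Finset.card_image_le
      · simp
    _ = _ := by omega

lemma total_le (h : IsBroom G m q) (hG : G.IsTree) (hq : 1 ≤ q) {p : ℕ}
    (hp : Fintype.card V = q + p) :
    treeNumRed G + treeNumBlue G ≤ 1 + (p + 1).choose 2 + q.choose 2 + Fintype.card V := by
  have h1 := h.numRed_le hG hq hp
  have h2 := h.numBlue_le hG hq hp
  rw [Nat.choose_succ_succ' p 1, Nat.choose_one_right]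
  simp only [Nat.reduceAdd]
  omega

end IsBroom

lemma spq_adj {p q : ℕ} (hq : 1 ≤ q) (i j : Fin (q + p)) :
    (Spq p q).Adj i j ↔ min (i : ℕ) q + 1 = min (j : ℕ) q ∨ min (j : ℕ) q + 1 = min (i : ℕ) q := by
  rw [Spq, SimpleGraph.fromRel_adj, ne_eq, Fin.ext_iff]
  omega

lemma iso_spq_iff {p q : ℕ} (hq : 1 ≤ q) (hp : Fintype.card V = q + p) :
    Nonempty (G ≃g Spq p q) ↔ ∃ m, IsBroom G m q := by
  constructor
  · rintro ⟨e⟩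
    exact ⟨_, .of_equiv e.toEquiv (by omega) fun u v => by
      rw [← spq_adj hq]
      exact e.map_adj_iff.symm⟩
  · rintro ⟨m, h⟩
    obtain ⟨e, he⟩ := h.exists_equiv hp
    exact ⟨⟨e, fun {u v} => by rw [spq_adj hq, he, he, h.adj]⟩⟩

lemma iso_path_iff : Nonempty (G ≃g SimpleGraph.pathGraph (Fintype.card V)) ↔
    ∃ m, IsBroom G m (Fintype.card V) := by
  have key : ∀ i j : Fin (Fintype.card V), (SimpleGraph.pathGraph (Fintype.card V)).Adj i j ↔
      min (i : ℕ) (Fintype.card V) + 1 = min (j : ℕ) (Fintype.card V) ∨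
      min (j : ℕ) (Fintype.card V) + 1 = min (i : ℕ) (Fintype.card V) := by
    intro i j
    rw [SimpleGraph.pathGraph_adj]
    omega
  constructor
  · rintro ⟨e⟩
    exact ⟨_, .of_equiv e.toEquiv le_rfl fun u v => by rw [← key]; exact e.map_adj_iff.symm⟩
  · rintro ⟨m, h⟩
    obtain ⟨e, he⟩ := h.exists_equiv (p := 0) rfl
    exact ⟨⟨e, fun {u v} => (key _ _).trans (by erw [he, he, h.adj])⟩⟩

lemma total_of_degree_le_two (hG : G.IsTree) (h : ∀ x, G.degree x ≤ 2) (hn : 2 ≤ Fintype.card V) :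
    treeNumRed G + treeNumBlue G = 1 + (Fintype.card V).choose 2 := by
  have hcol : ∀ u v p, Collin G u v p := by
    intro u v p
    by_contra hp
    obtain ⟨x, -, -, -, hx⟩ := exists_branch_between hG hp
    have := h x
    omega
  obtain ⟨a, b, hab⟩ := Fintype.one_lt_card_iff.1 hn
  have h1 : treeRedLines G = {Set.univ} := by
    have key : ∀ u v, treeRedLine G u v = Set.univ :=
      fun u v => Set.eq_univ_of_forall fun p => mem_red.2 (hcol u v p)
    ext L
    constructor
    · rintro ⟨u, v, -, rfl⟩
      exact key u v
    · rintro rfl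
      exact ⟨a, b, hab, (key a b).symm⟩
  have h2 : treeBlueLines G = blueIn G Finset.univ := by
    ext L
    simp only [Finset.mem_coe, mem_blueIn, Finset.mem_univ, true_and]
    exact ⟨fun ⟨u, v, huv, h⟩ => ⟨u, v, huv, h.symm⟩, fun ⟨u, v, huv, h⟩ => ⟨u, v, huv, h.symm⟩⟩
  rw [treeNumRed, treeNumBlue, h1, h2, Set.ncard_singleton, Set.ncard_coe_finset, card_blueIn,
    Finset.card_univ]
  intro u _ v _ u' _ v' _ _ _ h
  rw [blue_eq_pair (hcol u v), blue_eq_pair (hcol u' v')] at h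
  have : u ∈ ({u', v'} : Set V) := h ▸ by simp
  simpa using this

lemma IsBroom.degree_le_two {m : V → ℕ} {q : ℕ} (h : IsBroom G m q) {u : V} (hu : m u + 1 < q) :
    G.degree u ≤ 2 := by
  by_contra! hd
  obtain ⟨a, ha, -⟩ := exists_third hd u u
  obtain ⟨b, hb, hba, -⟩ := exists_third hd a a
  obtain ⟨c, hc, hca, hcb⟩ := exists_third hd a b
  rw [h.adj] at ha hb hc
  have h1 := h.inj b a (by omega)
  have h2 := h.inj c a (by omega)
  have h3 := h.inj c b (by omega)
  have : m b = m a ∨ m c = m a ∨ m c = m b := by omega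
  tauto

lemma exists_isBroom_card_iff (hG : G.IsTree) (hn : 2 ≤ Fintype.card V) :
    (∃ m, IsBroom G m (Fintype.card V)) ↔ ∀ x, G.degree x ≤ 2 := by
  constructor
  · rintro ⟨m, h⟩ x
    by_contra! hd
    have h1 := h.card_eq
    have h2 : ∀ v, m v < Fintype.card V := by
      intro v
      refine (h.le v).lt_of_ne fun hv => ?_
      have : 0 < (Finset.univ.filter fun v => m v = Fintype.card V).card :=
        Finset.card_pos.2 ⟨v, by simpa using hv⟩
      omega
    obtain ⟨a, ha, -⟩ := exists_third hd x x
    obtain ⟨b, hb, hba, -⟩ := exists_third hd a a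
    obtain ⟨c, hc, hca, hcb⟩ := exists_third hd a b
    rw [h.adj] at ha hb hc
    have h3 := h.inj b a (h2 b)
    have h4 := h.inj c a (h2 c)
    have h5 := h.inj c b (h2 c)
    have : m b = m a ∨ m c = m a ∨ m c = m b := by omega
    tauto
  · intro h
    obtain ⟨l, hl⟩ := exists_leaf hG hn
    obtain ⟨v, -, hv⟩ := Finset.exists_max_image Finset.univ (G.dist l) ⟨l, Finset.mem_univ l⟩
    have h1 : IsBroom G (G.dist l) (G.dist l v + 1) :=
      isBroom_of_levels hG (v := v) (fun w => (hv w (Finset.mem_univ w)).trans (Nat.le_succ _))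
        le_rfl fun a b ha hab => level_unique hG hl (fun p _ => h p) hab (M := G.dist l a) le_rfl
    have h2 := h1.card_eq
    rw [Finset.card_eq_zero.2, add_zero] at h2
    · exact ⟨_, h2 ▸ h1⟩
    · refine Finset.filter_eq_empty_iff.2 fun w _ hw => ?_
      have := hv w (Finset.mem_univ w)
      omega

lemma IsBroom.card_deg2 {m : V → ℕ} {q : ℕ} (h : IsBroom G m q) (hq : 2 ≤ q) {x : V}
    (hx : m x + 1 = q) (hd : 3 ≤ G.degree x) : (deg2 G).card + 2 = q := by
  obtain ⟨r, hr⟩ := h.ex 0 (by omega)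
  have hrx : r ≠ x := by
    rintro rfl
    omega
  have h1 : deg2 G = ((Finset.univ.filter fun v => m v < q).erase r).erase x := by
    ext u
    simp only [mem_deg2, Finset.mem_erase, Finset.mem_filter, Finset.mem_univ, true_and]
    constructor
    · intro hu
      obtain ⟨a, ha, -⟩ := exists_second hu.ge u
      obtain ⟨b, hb, hba⟩ := exists_second hu.ge a
      rw [h.adj] at ha hb
      have hne : m b < q → m b ≠ m a := fun h1 h2 => hba (h.inj b a h1 h2)
      have hle := h.le u
      have hla := h.le a
      have hlb := h.le b
      refine ⟨?_, ?_, ?_⟩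
      · rintro rfl
        omega
      · rintro rfl
        omega
      · omega
    · rintro ⟨hux, hur, huq⟩
      have h2 : m u + 1 ≠ q := fun h2 => hux (h.inj u x huq (by omega))
      have h3 : m u ≠ 0 := fun h3 => hur (h.inj u r huq (by omega))
      obtain ⟨a, ha⟩ := h.ex (m u - 1) (by omega)
      obtain ⟨b, hb⟩ := h.ex (m u + 1) (by omega)
      refine (h.degree_le_two (by omega)).antisymm ?_
      have hab : a ≠ b := by
        rintro rfl
        omega
      rw [← G.card_neighborFinset_eq_degree, ← Finset.card_pair hab]
      refine Finset.card_le_card fun y hy => ?_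
      rw [SimpleGraph.mem_neighborFinset, h.adj]
      simp only [Finset.mem_insert, Finset.mem_singleton] at hy
      rcases hy with rfl | rfl <;> omega
  rw [h1, Finset.card_erase_of_mem, Finset.card_erase_of_mem, h.card_below]
  · omega
  · simp [hr]
    omega
  · simp only [Finset.mem_erase, Finset.mem_filter, Finset.mem_univ, true_and]
    exact ⟨hrx.symm, by omega⟩

lemma sum_choose_two {a b n : ℕ} (h : a + b = n + 1) :
    n ^ 2 / 4 ≤ a.choose 2 + b.choose 2 ∧
      (a.choose 2 + b.choose 2 = n ^ 2 / 4 ↔ a ≤ b + 1 ∧ b ≤ a + 1) := by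
  have key : ∀ c : ℕ, (c.choose 2 : ℤ) * 2 + c = c * c := by
    intro c
    cases c with
    | zero => rfl
    | succ c =>
      have := succ_choose_two_mul_two c
      zify at this
      push_cast
      linarith
  have ha := key a
  have hb := key b
  have hn : (n : ℤ) = a + b - 1 := by omega
  have h4 : 4 * ((a.choose 2 : ℤ) + b.choose 2) + 1 = (n : ℤ) ^ 2 + ((a : ℤ) - b) ^ 2 := by
    rw [hn]
    linarith
  zify
  generalize (n : ℤ) ^ 2 = N at *
  generalize (a.choose 2 : ℤ) = A at *
  generalize (b.choose 2 : ℤ) = B at *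
  by_cases hd : a ≤ b + 1 ∧ b ≤ a + 1
  · have : ((a : ℤ) - b) ^ 2 = 0 ∨ ((a : ℤ) - b) ^ 2 = 1 := by
      have : (a : ℤ) - b = 0 ∨ (a : ℤ) - b = 1 ∨ (a : ℤ) - b = -1 := by omega
      rcases this with h | h | h <;> simp [h]
    omega
  · have : 4 ≤ ((a : ℤ) - b) ^ 2 := by
      have : (a : ℤ) - b ≤ -2 ∨ 2 ≤ (a : ℤ) - b := by omega
      rcases this with h | h <;> nlinarith
    omega

lemma tBound_le (n : ℕ) (hn : 3 ≤ n) :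
    tBound n ≤ n ^ 2 / 4 + n + 1 ∧ (n < 6 → tBound n < n ^ 2 / 4 + n + 1) := by
  rcases Nat.lt_or_ge n 6 with h | h
  · interval_cases n <;> decide
  · simp [tBound, h, Nat.not_lt.2 h]

lemma tBound_le_choose (n : ℕ) (hn : 3 ≤ n) :
    tBound n ≤ 1 + n.choose 2 ∧ (tBound n = 1 + n.choose 2 ↔ n ≤ 6) := by
  rcases Nat.lt_or_ge n 7 with h | h
  · interval_cases n <;> decide
  · obtain ⟨k, rfl⟩ := Nat.exists_eq_add_of_le h
    have h1 := succ_choose_two_mul_two (6 + k)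
    have h2 : (7 + k) ^ 2 / 4 + (7 + k) + 1 < 1 + (7 + k).choose 2 := by
      rw [show 6 + k + 1 = 7 + k by omega] at h1
      have h3 : (7 + k) ^ 2 = (6 + k) * (6 + k) + 2 * (6 + k) + 1 := by ring
      have h4 : (6 + k) * (6 + k) = k * k + 12 * k + 36 := by ring
      omega
    simp only [tBound, if_pos (show 6 ≤ 7 + k by omega)]
    omega

lemma tBound_lt_of_star (n : ℕ) (hn : 4 ≤ n) : tBound n < 1 + (n - 1).choose 2 + n := by
  rcases Nat.lt_or_ge n 6 with h | h
  · interval_cases n <;> decide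
  · obtain ⟨k, rfl⟩ := Nat.exists_eq_add_of_le h
    have h1 := succ_choose_two_mul_two (4 + k)
    rw [show 4 + k + 1 = 6 + k - 1 by omega] at h1
    have h3 : (6 + k) ^ 2 = (4 + k) * (4 + k) + 4 * (4 + k) + 4 := by ring
    have h4 : (4 + k) * (4 + k) = k * k + 8 * k + 16 := by ring
    simp only [tBound, if_pos h]
    omega

lemma tBound_le_of_branch (hG : G.IsTree) {x : V} (hx : 3 ≤ G.degree x) :
    tBound (Fintype.card V) ≤ treeNumRed G + treeNumBlue G ∧
      (treeNumRed G + treeNumBlue G = tBound (Fintype.card V) → 6 ≤ Fintype.card V ∧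
        ∃ m p q, IsBroom G m q ∧ 2 ≤ q ∧ Fintype.card V = q + p ∧ p ≤ q ∧ q ≤ p + 2) := by
  have hn : 4 ≤ Fintype.card V := hx.trans_lt (G.degree_lt_card_verts x)
  rcases (deg2 G).eq_empty_or_nonempty with h0 | ⟨u, hu⟩
  · have h1 := total_lower_of_no_deg2 hG hx h0 (by omega)
    have h2 := tBound_lt_of_star _ hn
    omega
  have hu2 := mem_deg2.1 hu
  have h1 := total_lower hG hx hu2 (by omega)
  have h2 := card_ends_add_card_deg2 G
  have h3 : 0 < (ends G).card := Finset.card_pos.2 ⟨x, by simp; omega⟩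
  have h4 := sum_choose_two (a := Fintype.card V - (deg2 G).card - 1) (b := (deg2 G).card + 2)
    (n := Fintype.card V) (by omega)
  have h5 := tBound_le (Fintype.card V) (by omega)
  have h6 := Finset.single_le_sum (f := fun u => (blueFrom G u).card - 3)
    (fun _ _ => Nat.zero_le _) hu
  refine ⟨by omega, fun h => ?_⟩
  obtain ⟨m, q, hq, hm, hxq⟩ := exists_isBroom hG hu2 (by omega) hx
  have h7 := hm.card_deg2 hq hxq hx
  have h8 := hm.card_eq
  have h9 := h4.2.1 (by omega)
  exact ⟨by omega, m, _, q, hm, hq, h8, by omega, by omega⟩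

lemma tBound_le_total (hG : G.IsTree) (hn : 3 ≤ Fintype.card V) :
    tBound (Fintype.card V) ≤ treeNumRed G + treeNumBlue G := by
  by_cases h : ∀ x, G.degree x ≤ 2
  · rw [total_of_degree_le_two hG h (by omega)]
    exact (tBound_le_choose _ hn).1
  · push Not at h
    obtain ⟨x, hx⟩ := h
    exact (tBound_le_of_branch hG hx).1

end

end TreeLines

/-- For the system derived from a tree `T` on `n ≥ 3` vertices, `m_S = t(n)`
iff either `n ≤ 6` and `T` is a path, or `n ≥ 6` and `T ≅ S(a*, n − a*)` with
`a* = (n−1)/2` for odd `n` and `a* ∈ {n/2 − 1, n/2}` for even `n`. -/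
theorem stmt_18 {V : Type*} [Fintype V] (G : SimpleGraph V) (hG : G.IsTree)
    (hn : 3 ≤ Fintype.card V) :
    treeNumRed G + treeNumBlue G = tBound (Fintype.card V) ↔
      ((Fintype.card V ≤ 6 ∧
          Nonempty (G ≃g SimpleGraph.pathGraph (Fintype.card V))) ∨
       (6 ≤ Fintype.card V ∧
          ∃ a : ℕ,
            ((Odd (Fintype.card V) ∧ a = (Fintype.card V - 1) / 2) ∨
             (Even (Fintype.card V) ∧
                (a = Fintype.card V / 2 - 1 ∨ a = Fintype.card V / 2))) ∧
            Nonempty (G ≃g Spq a (Fintype.card V - a)))) := by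
  constructor
  · intro h
    by_cases hd : ∀ x, G.degree x ≤ 2
    · rw [TreeLines.total_of_degree_le_two hG hd (by omega)] at h
      exact Or.inl ⟨(TreeLines.tBound_le_choose _ hn).2.1 h.symm,
        TreeLines.iso_path_iff.2 ((TreeLines.exists_isBroom_card_iff hG (by omega)).2 hd)⟩
    · push Not at hd
      obtain ⟨x, hx⟩ := hd
      obtain ⟨h6, m, p, q, hm, hq, hpq, h1, h2⟩ := (TreeLines.tBound_le_of_branch hG hx).2 h
      refine Or.inr ⟨h6, p, ?_, ?_⟩
      · rw [Nat.odd_iff, Nat.even_iff]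
        omega
      · rw [show Fintype.card V - p = q by omega]
        exact (TreeLines.iso_spq_iff (by omega) hpq).2 ⟨m, hm⟩
  · rintro (⟨h6, h⟩ | ⟨h6, p, hp, h⟩)
    · rw [TreeLines.total_of_degree_le_two hG ((TreeLines.exists_isBroom_card_iff hG (by omega)).1
        (TreeLines.iso_path_iff.1 h)) (by omega)]
      exact ((TreeLines.tBound_le_choose _ hn).2.2 h6).symm
    · rw [Nat.odd_iff, Nat.even_iff] at hp
      have hpq : Fintype.card V = Fintype.card V - p + p := by omega
      obtain ⟨m, hm⟩ := (TreeLines.iso_spq_iff (by omega) hpq).1 h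
      refine le_antisymm ?_ (TreeLines.tBound_le_total hG hn)
      have h1 := hm.total_le hG (by omega) hpq
      have h2 := (TreeLines.sum_choose_two (a := p + 1) (b := Fintype.card V - p)
        (n := Fintype.card V) (by omega)).2.2 (by omega)
      rw [tBound, if_pos h6]
      omega
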